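/- arXiv:2410.06095 — 2 statements merged into one kernel-verified Lean document; each statement's English description precedes it below -/
import Mathlib

section
/- Let G be a connected finite graph with V_{2,3}(G) ≠ ∅, and suppose that the canonical stable colouring of colour refinement assigns pairwise distinct colours to the vertices of V_{2,3}(G) (i.e. c_G^{|V(G)|} is injective on V_{2,3}(G)). Then G is CR-determined: for every finite graph H with |V(H)| = |V(G)|, if for every t ≥ 0 the multiset {c_H^t(v) : v ∈ V(H)} equals the multiset {c_G^t(v) : v ∈ V(G)}, then H is isomorphic to G. -/
open MeasureTheory Filter

/-- Product of (independent) Bernoulli distributions on `ι → Bool`, with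
success probability `q i` in coordinate `i`. -/
noncomputable def bernoulliProduct (ι : Type*) [Fintype ι] [DecidableEq ι] (q : ι → ℝ) :
    Measure (ι → Bool) :=
  ∑ f : ι → Bool,
    (∏ i : ι, if f i then ENNReal.ofReal (q i) else ENNReal.ofReal (1 - q i)) •
      Measure.dirac f

/-- The Erdős–Rényi measure: each (potential) edge of the complete graph on `Fin n`
is present independently with probability `p`; encoded as a random `Sym2 (Fin n) → Bool`. -/
noncomputable def erdosRenyiMeasure (n : ℕ) (p : ℝ) : Measure (Sym2 (Fin n) → Bool) :=
  bernoulliProduct (Sym2 (Fin n)) fun _ => p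

/-- The graph on `Fin n` determined by an edge-indicator function. -/
def graphOfFlip {n : ℕ} (f : Sym2 (Fin n) → Bool) : SimpleGraph (Fin n) :=
  SimpleGraph.fromRel fun u v => f s(u, v) = true

/-- Symmetric difference of two graphs on the same vertex set. -/
def symmDiffG {V : Type*} (G₁ G₂ : SimpleGraph V) : SimpleGraph V :=
  SimpleGraph.fromRel fun u v => Xor' (G₁.Adj u v) (G₂.Adj u v)

/-- `crEquiv G c t u v` : vertices `u` and `v` get the same colour after `t` rounds of
colour refinement on `G`, starting from the colouring `c`. -/
def crEquiv {V : Type*} {Ω : Type*} (G : SimpleGraph V) (c : V → Ω) : ℕ → V → V → Prop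
  | 0, u, v => c u = c v
  | (t + 1), u, v => crEquiv G c t u v ∧ ∀ w : V,
      Nat.card {x : V // G.Adj u x ∧ crEquiv G c t x w} =
      Nat.card {x : V // G.Adj v x ∧ crEquiv G c t x w}

/-- `u` and `v` get the same colour in the stable colouring `R* c`. -/
def crStable {V : Type*} {Ω : Type*} (G : SimpleGraph V) (c : V → Ω) (u v : V) : Prop :=
  ∀ t, crEquiv G c t u v

/-- `u` and `v` get the same colour in the stable colouring `R* σ`
(colour refinement started from the trivial colouring). -/
def crStableTrivial {V : Type*} (G : SimpleGraph V) (u v : V) : Prop :=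
  crStable G (fun _ => (0 : ℕ)) u v

/-- Equality of the initial pair-colourings `φ_{G,c}` on two ordered pairs of vertices. -/
def wl2Init {V : Type*} {Ω : Type*} (G : SimpleGraph V) (c : V → Ω) (p q : V × V) : Prop :=
  (G.Adj p.1 p.2 ↔ G.Adj q.1 q.2) ∧ (p.1 = p.2 ↔ q.1 = q.2) ∧
    (p.1 = p.2 → q.1 = q.2 → c p.2 = c q.2)

/-- `wl2Equiv G c t p q` : the ordered pairs `p` and `q` get the same colour after `t` rounds of
the 2-dimensional Weisfeiler–Leman refinement on `G`, started from `φ_{G,c}`. -/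
def wl2Equiv {V : Type*} {Ω : Type*} (G : SimpleGraph V) (c : V → Ω) :
    ℕ → V × V → V × V → Prop
  | 0, p, q => wl2Init G c p q
  | (t + 1), p, q => wl2Equiv G c t p q ∧ ∀ r s : V × V,
      Nat.card {w : V // wl2Equiv G c t (p.1, w) r ∧ wl2Equiv G c t (w, p.2) s} =
      Nat.card {w : V // wl2Equiv G c t (q.1, w) r ∧ wl2Equiv G c t (w, q.2) s}

/-- `u` and `v` get the same colour in the vertex colouring `V* c` obtained from the stable
pair colouring of the 2-dimensional Weisfeiler–Leman algorithm started from `φ_{G,c}`. -/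
def wl2VertexEquiv {V : Type*} {Ω : Type*} (G : SimpleGraph V) (c : V → Ω) (u v : V) : Prop :=
  ∀ t, wl2Equiv G c t (u, u) (v, v)

/-- Given a colouring of `V(H)` encoded as the equivalence relation `r` ("has the same colour"),
`majority H r u v` says that at least half of the possible edges between the colour class of `u`
and the colour class of `v` are present in `H` (counting ordered pairs). -/
def majority {V : Type*} (H : SimpleGraph V) (r : V → V → Prop) (u v : V) : Prop :=
  Nat.card {p : V × V // p.1 ≠ p.2 ∧ r p.1 u ∧ r p.2 v} ≤
    2 * Nat.card {p : V × V // p.1 ≠ p.2 ∧ r p.1 u ∧ r p.2 v ∧ H.Adj p.1 p.2}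

/-- The disparity graph `D(H,c)`, for the colouring encoded by the relation `r`. -/
def disparity {V : Type*} (H : SimpleGraph V) (r : V → V → Prop) : SimpleGraph V :=
  SimpleGraph.fromRel fun u v => Xor' (H.Adj u v) (majority H r u v)

/-- The generalised disparity graph `D_L(H,c)` for a 0-1 matrix `L` on colours. -/
def gDisparity {V : Type*} {Ω : Type*} (H : SimpleGraph V) (c : V → Ω) (L : Ω → Ω → Bool) :
    SimpleGraph V :=
  SimpleGraph.fromRel fun u v => Xor' (H.Adj u v) (L (c u) (c v) = true)

/-- The vertex set of the connected component of `v` in `G`. -/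
def compSet {V : Type*} (G : SimpleGraph V) (v : V) : Set V := {u | G.Reachable v u}

/-- A colouring is equitable if any two vertices with the same colour have the same number of
neighbours in every colour class. -/
def IsEquitable {V : Type*} {Ω : Type*} (H : SimpleGraph V) (c : V → Ω) : Prop :=
  ∀ u v, c u = c v → ∀ a : Ω,
    Nat.card {x : V // H.Adj u x ∧ c x = a} = Nat.card {x : V // H.Adj v x ∧ c x = a}

/-- Vertex set of the `k`-core of `G`: the union of all vertex sets inducing minimum
degree at least `k`. -/
def kCore {V : Type*} (G : SimpleGraph V) (k : ℕ) : Set V :=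
  ⋃₀ {S : Set V | ∀ v ∈ S, k ≤ Nat.card {u : V // u ∈ S ∧ G.Adj v u}}

/-- `V_{2,3}(G)`: vertices of the 2-core of `G` having degree at least 3 in the 2-core. -/
def V23 {V : Type*} (G : SimpleGraph V) : Set V :=
  {v | v ∈ kCore G 2 ∧ 3 ≤ Nat.card {u : V // u ∈ kCore G 2 ∧ G.Adj v u}}

/-- The graph obtained from `G` by deleting all edges meeting `T`
(so that reachability in `avoidG G T` from `v ∉ T` is reachability in `G - T`). -/
def avoidG {V : Type*} (G : SimpleGraph V) (T : Set V) : SimpleGraph V :=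
  SimpleGraph.fromRel fun u v => G.Adj u v ∧ u ∉ T ∧ v ∉ T

/-- `V_{2,3}^{safe}(G)`: vertices `v ∈ V_{2,3}(G)` such that after deleting any set of at most
two other vertices, the component of `v` still contains at least 3 vertices of `V_{2,3}(G)`. -/
def V23safe {V : Type*} (G : SimpleGraph V) : Set V :=
  {v | v ∈ V23 G ∧ ∀ T : Finset V, T.card ≤ 2 → v ∉ T →
    3 ≤ Nat.card {w : V // w ∈ V23 G ∧ (avoidG G (T : Set V)).Reachable v w}}

open Classical in
/-- `Lmul G i u v w` is the multiplicity of the vertex `w` in the multiset `L^i_G(u,v)`. -/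
noncomputable def Lmul {V : Type*} [Fintype V] (G : SimpleGraph V) : ℕ → V → V → V → ℕ
  | 0, u, _, w => if w = u then 1 else 0
  | (i + 1), u, v, w =>
      (∑ x : V, if G.Adj w x then Lmul G i u v x else 0) -
        (∑ x : V, if G.Adj w x then Lmul G i v u x else 0)

/-- Union over `j < i` of the supports of `L^j_G(u,v)` and `L^j_G(v,u)`. -/
noncomputable def Sbelow {V : Type*} [Fintype V] (G : SimpleGraph V) (u v : V) (i : ℕ) :
    Set V :=
  {w | ∃ j < i, 0 < Lmul G j u v w ∨ 0 < Lmul G j v u w}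

/-- `S^{≤ i}_G({u,v})`. -/
noncomputable def Sle {V : Type*} [Fintype V] (G : SimpleGraph V) (u v : V) (i : ℕ) : Set V :=
  Sbelow G u v (i + 1)

/-- `S^{i}_G({u,v}) = S^{≤ i}_G({u,v}) \ S^{≤ i-1}_G({u,v})`. -/
noncomputable def Sat {V : Type*} [Fintype V] (G : SimpleGraph V) (u v : V) (i : ℕ) : Set V :=
  Sbelow G u v (i + 1) \ Sbelow G u v i

/-- Degree of a vertex (as `Nat.card` of the neighbour set, avoiding decidability issues). -/
noncomputable def ncDegree {V : Type*} (G : SimpleGraph V) (v : V) : ℕ :=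
  Nat.card {u : V // G.Adj v u}

/-- The random refinement of a colouring `c`: each vertex `v` with `f v = true` receives
a brand-new colour unique to itself. -/
def refineColor {V : Type*} {Ω : Type*} (c : V → Ω) (f : V → Bool) : V → Ω ⊕ V :=
  fun v => if f v then Sum.inr v else Sum.inl (c v)

/-- `D(H,c)` (for the colouring encoded by the relation `r`) is `s`-bounded: every
intersection of a colour class with a connected component of `D(H,c)` has at most
`s` elements. -/
def sBounded {V : Type*} (H : SimpleGraph V) (r : V → V → Prop) (s : ℕ) : Prop :=
  ∀ u v : V, Nat.card {w : V // r w u ∧ w ∈ compSet (disparity H r) v} ≤ s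

/-- The type of canonical colours after `t` rounds of colour refinement. -/
def CCol : ℕ → Type
  | 0 => Unit
  | (t + 1) => CCol t × Multiset (CCol t)

open Classical in
/-- The canonical colour of a vertex after `t` rounds of colour refinement. -/
noncomputable def canonColor {V : Type*} [Fintype V] (G : SimpleGraph V) :
    (t : ℕ) → V → CCol t
  | 0, _ => ()
  | (t + 1), v =>
      (canonColor G t v, (Finset.univ.filter fun w => G.Adj v w).val.map (canonColor G t))

/-- The modal probability `M(m,p)` of a `Binomial(m,p)` random variable. -/
noncomputable def modalProb (m : ℕ) (p : ℝ) : ℝ :=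
  (m.choose ⌊(m + 1 : ℝ) * p⌋₊ : ℝ) * p ^ ⌊(m + 1 : ℝ) * p⌋₊ *
    (1 - p) ^ (m - ⌊(m + 1 : ℝ) * p⌋₊)


theorem exists_equiv_comp_eq {X Y X' Y' : Type*} [Finite X] [Finite X'] (f : X → Y) (g : X' → Y')
    (h : Y ≃ Y') (hc : ∀ y, Nat.card {x // f x = y} = Nat.card {x' // g x' = h y}) :
    ∃ e : X ≃ X', ∀ x, g (e x) = h (f x) := by
  have ε (y : Y) : {x // f x = y} ≃ {x' // g x' = h y} := (Finite.card_eq.1 (hc y)).some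
  refine ⟨(Equiv.sigmaFiberEquiv f).symm.trans
    ((Equiv.sigmaCongr h ε).trans (Equiv.sigmaFiberEquiv g)), fun x => ?_⟩
  exact (ε (f x) ⟨x, rfl⟩).2

theorem Equiv.Perm.cycleType_of_involutive {X : Type*} [Fintype X] [DecidableEq X]
    (σ : Equiv.Perm X) (hσ : Function.Involutive σ) (hne : ∀ x, σ x ≠ x) :
    σ.cycleType = Multiset.replicate (Fintype.card X / 2) 2 := by
  have h1 := Equiv.Perm.cycleType_of_pow_prime_eq_one (σ := σ) (p := 2)
    (by ext x; simpa [pow_two] using hσ x)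
  have h2 := σ.sum_cycleType
  have h3 : σ.support = Finset.univ := by ext x; simpa using hne x
  rw [h3, Finset.card_univ, h1, Multiset.sum_replicate, smul_eq_mul] at h2
  rw [← h2, Nat.mul_div_cancel _ two_pos]
  exact h1

theorem exists_equiv_semiconj_of_involutive {X X' : Type*} [Finite X] [Finite X']
    (hcard : Nat.card X = Nat.card X') (σ : X → X) (τ : X' → X') (hσ : Function.Involutive σ)
    (hτ : Function.Involutive τ) (hσ' : ∀ x, σ x ≠ x) (hτ' : ∀ x, τ x ≠ x) :
    ∃ e : X ≃ X', ∀ x, e (σ x) = τ (e x) := by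
  classical
  have := Fintype.ofFinite X
  let e₀ : X ≃ X' := (Finite.card_eq.1 hcard).some
  let ρ : Equiv.Perm X := (e₀.trans (hτ.toPerm τ)).trans e₀.symm
  have hρ : ∀ x, ρ x = e₀.symm (τ (e₀ x)) := fun _ => rfl
  have hconj : IsConj (hσ.toPerm σ) ρ := by
    rw [Equiv.Perm.isConj_iff_cycleType_eq, Equiv.Perm.cycleType_of_involutive _ hσ hσ',
      Equiv.Perm.cycleType_of_involutive]
    · intro x
      simp [hρ, hτ _]
    · intro x h
      rw [hρ, Equiv.symm_apply_eq] at h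
      exact hτ' _ h
  obtain ⟨π, hπ⟩ := isConj_iff.1 hconj
  refine ⟨π.trans e₀, fun x => ?_⟩
  have := congrArg (fun q : Equiv.Perm X => e₀ (q (π x))) hπ
  simpa [hρ] using this

/-- Two coloured graphs in which vertices of the same colour (one from each graph) have equally
many neighbours in every set of colours. -/
def CrossEquitable {V W C : Type*} (G : SimpleGraph V) (H : SimpleGraph W) (c : V → C)
    (d : W → C) : Prop :=
  ∀ v w, c v = d w → ∀ Q : Set C,
    Nat.card {x // G.Adj v x ∧ c x ∈ Q} = Nat.card {y // H.Adj w y ∧ d y ∈ Q}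

theorem exists_forall_adj_iff_eq {V C : Type*} (G : SimpleGraph V)
    {c : V → C} {P : Set C} {b : C} (hb : b ∈ P) {v : V}
    (hP : Nat.card {x // G.Adj v x ∧ c x ∈ P} = 1)
    (hv : Nat.card {x // G.Adj v x ∧ c x ∈ ({b} : Set C)} ≠ 0) :
    ∃ u : {u // c u = b}, ∀ x, G.Adj v x ∧ c x ∈ P ↔ x = u := by
  obtain ⟨⟨u, hu, hub⟩⟩ := (Nat.card_ne_zero.1 hv).1
  rw [Nat.card_eq_one_iff_unique] at hP
  have := hP.1
  have hub' : c u = b := hub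
  have huP : c u ∈ P := by rwa [hub']
  refine ⟨⟨u, hub'⟩, fun x => ⟨fun hx => ?_, ?_⟩⟩
  · exact congrArg Subtype.val
      (Subsingleton.elim (⟨x, hx⟩ : {x // G.Adj v x ∧ c x ∈ P}) ⟨u, hu, huP⟩)
  · rintro rfl
    exact ⟨hu, huP⟩

/-- Coloured forests are identified by colour refinement. -/
theorem CrossEquitable.exists_fiberwise_equiv {V W C : Type*} [Finite V] [Finite W]
    {G : SimpleGraph V} {H : SimpleGraph W} {c : V → C} {d : W → C}
    (hGH : CrossEquitable G H c d)
    (hsize : ∀ a, Nat.card {v // c v = a} = Nat.card {w // d w = a}) (P : Finset C)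
    (hP : ∀ S : Set V, (∀ v ∈ S, c v ∈ P) →
      (∀ v ∈ S, 2 ≤ Nat.card {u // u ∈ S ∧ G.Adj v u}) → S = ∅) :
    ∃ E : ∀ a, {v // c v = a} ≃ {w // d w = a},
      ∀ a ∈ P, ∀ b ∈ P, ∀ x y, G.Adj x.1 y.1 ↔ H.Adj (E a x).1 (E b y).1 := by
  classical
  induction P using Finset.strongInduction with
  | H P ih =>
  by_cases hex : ∃ v, c v ∈ P
  swap
  · exact ⟨fun a => (Finite.card_eq.1 (hsize a)).some,
      fun a ha _ _ x _ => (hex ⟨x.1, by rwa [x.2]⟩).elim⟩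
  obtain ⟨v₀, hv₀, hdeg⟩ : ∃ v, c v ∈ P ∧ Nat.card {u // G.Adj v u ∧ c u ∈ (P : Set C)} < 2 := by
    by_contra! hcon
    obtain ⟨v, hv⟩ := hex
    have := hP {v | c v ∈ P} (fun _ h => h) fun v hv => by
      simpa [and_comm] using hcon v hv
    exact Set.eq_empty_iff_forall_notMem.1 this v hv
  obtain ⟨a, ha⟩ : ∃ a, c v₀ = a := ⟨_, rfl⟩
  rw [ha] at hv₀
  obtain ⟨E, hE⟩ := ih (P.erase a) (Finset.erase_ssubset hv₀) fun S hS =>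
    hP S fun v hv => Finset.mem_of_mem_erase (hS v hv)
  have hcard (v : V) (b : C) (hv : c v = b) (Q : Set C) := hGH v (E b ⟨v, hv⟩).1
    (hv.trans (E b ⟨v, hv⟩).2.symm) Q
  have hW (w : {w // d w = a}) (Q : Set C) : Nat.card {y // H.Adj w.1 y ∧ d y ∈ Q} =
      Nat.card {x // G.Adj v₀ x ∧ c x ∈ Q} :=
    (hGH v₀ w.1 (ha.trans w.2.symm) Q).symm
  have hV (v : {v // c v = a}) (Q : Set C) : Nat.card {x // G.Adj v.1 x ∧ c x ∈ Q} =
      Nat.card {x // G.Adj v₀ x ∧ c x ∈ Q} :=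
    (hcard v.1 a v.2 Q).trans (hW _ Q)
  suffices hs : ∃ e : {v // c v = a} ≃ {w // d w = a},
      (∀ b ∈ P, b ≠ a → ∀ x y, G.Adj x.1 y.1 ↔ H.Adj (e x).1 (E b y).1) ∧
      ∀ x y, G.Adj x.1 y.1 ↔ H.Adj (e x).1 (e y).1 by
    obtain ⟨e, he, he'⟩ := hs
    refine ⟨Function.update E a e, fun b hb b' hb' x y => ?_⟩
    by_cases hba : b = a
    · subst hba
      by_cases hba' : b' = b
      · subst hba'
        simpa using he' x y
      · simpa [hba'] using he b' hb' hba' x y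
    · by_cases hba' : b' = a
      · subst hba'
        rw [G.adj_comm, H.adj_comm]
        simpa [hba] using he b hb hba y x
      · simpa [hba, hba'] using
          hE b (Finset.mem_erase.2 ⟨hba, hb⟩) b' (Finset.mem_erase.2 ⟨hba', hb'⟩) x y
  by_cases hnbr : Nat.card {u // G.Adj v₀ u ∧ c u ∈ (P : Set C)} = 0
  · have hGn (x : {v // c v = a}) (u : V) (hu : c u ∈ P) : ¬ G.Adj x.1 u := fun h => by
      have h0 := (hV x P).trans hnbr
      rw [Finite.card_eq_zero_iff] at h0
      exact h0.elim ⟨u, h, hu⟩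
    have hHn (x : {w // d w = a}) (u : W) (hu : d u ∈ P) : ¬ H.Adj x.1 u := fun h => by
      have h0 := (hW x P).trans hnbr
      rw [Finite.card_eq_zero_iff] at h0
      exact h0.elim ⟨u, h, hu⟩
    exact ⟨E a, fun b hb _ x y => iff_of_false (hGn x y (by rwa [y.2]))
        (hHn _ _ (by rwa [(E b y).2])),
      fun x y => iff_of_false (hGn x y (by rwa [y.2])) (hHn _ _ (by rwa [(E a y).2]))⟩
  have hone : Nat.card {u // G.Adj v₀ u ∧ c u ∈ (P : Set C)} = 1 := by omega
  obtain ⟨⟨u₀, hu₀, hb⟩⟩ := (Nat.card_ne_zero.1 hnbr).1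
  obtain ⟨b, hu₀b⟩ : ∃ b, c u₀ = b := ⟨_, rfl⟩
  rw [hu₀b] at hb
  have hb₀ : Nat.card {u // G.Adj v₀ u ∧ c u ∈ ({b} : Set C)} ≠ 0 :=
    Nat.card_ne_zero.2 ⟨⟨u₀, hu₀, hu₀b⟩, inferInstance⟩
  choose n hn using fun x : {v // c v = a} => exists_forall_adj_iff_eq G hb
    ((hV x P).trans hone) ((hV x {b}).trans_ne hb₀)
  choose m hm using fun x : {w // d w = a} => exists_forall_adj_iff_eq H hb
    ((hW x P).trans hone) ((hW x {b}).trans_ne hb₀)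
  have hn' (x : {v // c v = a}) {b' : C} (hb' : b' ∈ P) (y : {v // c v = b'}) :
      G.Adj x.1 y.1 ↔ y.1 = (n x).1 := by
    rw [← hn x y.1, y.2]
    exact (and_iff_left hb').symm
  have hm' (x : {w // d w = a}) {b' : C} (hb' : b' ∈ P) (y : {w // d w = b'}) :
      H.Adj x.1 y.1 ↔ y.1 = (m x).1 := by
    rw [← hm x y.1, y.2]
    exact (and_iff_left hb').symm
  have hfar (e : {v // c v = a} ≃ {w // d w = a}) (b' : C) (hb' : b' ∈ P) (hne : b' ≠ b)
      (e' : {v // c v = b'} ≃ {w // d w = b'}) (x y) :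
      G.Adj x.1 y.1 ↔ H.Adj (e x).1 (e' y).1 := by
    rw [hn' x hb', hm' _ hb']
    refine iff_of_false (fun h => hne ?_) (fun h => hne ?_)
    · rw [← y.2, h, (n x).2]
    · rw [← (e' y).2, h, (m (e x)).2]
  by_cases hba : b = a
  · subst hba
    obtain ⟨e, he⟩ := exists_equiv_semiconj_of_involutive (hsize b) n m
      (fun x => (Subtype.ext ((hn' _ hb x).1 ((hn' x hb _).2 rfl).symm)).symm)
      (fun x => (Subtype.ext ((hm' _ hb x).1 ((hm' x hb _).2 rfl).symm)).symm)
      (fun x h => ((hn' x hb (n x)).2 rfl).ne (congrArg Subtype.val h).symm)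
      (fun x h => ((hm' x hb (m x)).2 rfl).ne (congrArg Subtype.val h).symm)
    refine ⟨e, fun b' hb' hne => hfar e b' hb' hne (E b'), fun x y => ?_⟩
    rw [hn' x hb, hm' _ hb, ← he, ← Subtype.ext_iff, ← Subtype.ext_iff, e.apply_eq_iff_eq]
  · obtain ⟨e, he⟩ := exists_equiv_comp_eq n m (E b) fun y => by
      have h1 : Nat.card {x // n x = y} = Nat.card {u // G.Adj y.1 u ∧ c u ∈ ({a} : Set C)} :=
        Nat.card_congr
          { toFun := fun x => ⟨x.1.1, ((hn' x.1 hb y).2 (congrArg Subtype.val x.2.symm)).symm,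
              x.1.2⟩
            invFun := fun u => ⟨⟨u.1, u.2.2⟩,
              (Subtype.ext ((hn' ⟨u.1, u.2.2⟩ hb y).1 u.2.1.symm)).symm⟩
            left_inv := fun _ => rfl
            right_inv := fun _ => rfl }
      have h2 : Nat.card {x // m x = E b y} =
          Nat.card {u // H.Adj (E b y).1 u ∧ d u ∈ ({a} : Set C)} :=
        Nat.card_congr
          { toFun := fun x => ⟨x.1.1,
              ((hm' x.1 hb (E b y)).2 (congrArg Subtype.val x.2.symm)).symm, x.1.2⟩
            invFun := fun u => ⟨⟨u.1, u.2.2⟩,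
              (Subtype.ext ((hm' ⟨u.1, u.2.2⟩ hb (E b y)).1 u.2.1.symm)).symm⟩
            left_inv := fun _ => rfl
            right_inv := fun _ => rfl }
      rw [h1, h2]
      exact hcard y.1 b y.2 {a}
    refine ⟨e, fun b' hb' _ x y => ?_, hfar e a hv₀ (Ne.symm hba) e⟩
    by_cases hbb : b' = b
    · subst hbb
      rw [hn' x hb, hm' _ hb, he, ← Subtype.ext_iff, ← Subtype.ext_iff, (E b').apply_eq_iff_eq]
    · exact hfar e b' hb' hbb (E b') x y

theorem subset_kCore {V : Type*} {G : SimpleGraph V} {k : ℕ} {S : Set V}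
    (hS : ∀ v ∈ S, k ≤ Nat.card {u // u ∈ S ∧ G.Adj v u}) : S ⊆ kCore G k :=
  Set.subset_sUnion_of_mem hS

theorem card_inter_neighbors_mono {V : Type*} [Finite V] (G : SimpleGraph V) {S T : Set V}
    (h : S ⊆ T) (v : V) :
    Nat.card {u // u ∈ S ∧ G.Adj v u} ≤ Nat.card {u // u ∈ T ∧ G.Adj v u} :=
  Nat.card_mono (Set.toFinite {u | u ∈ T ∧ G.Adj v u}) fun _ hu => ⟨h hu.1, hu.2⟩

theorem le_card_of_mem_kCore {V : Type*} [Finite V] {G : SimpleGraph V} {k : ℕ} {v : V}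
    (hv : v ∈ kCore G k) : k ≤ Nat.card {u // u ∈ kCore G k ∧ G.Adj v u} := by
  obtain ⟨S, hS, hvS⟩ := hv
  exact (hS v hvS).trans (card_inter_neighbors_mono G (subset_kCore hS) v)

/-- A path between two vertices of the 2-core stays inside the 2-core. -/
theorem mem_kCore_two_of_mem_support {V : Type*} [Finite V] {G : SimpleGraph V} {u v : V}
    (p : G.Walk u v) (hp : p.IsPath) (hu : u ∈ kCore G 2) (hv : v ∈ kCore G 2) {x : V}
    (hx : x ∈ p.support) : x ∈ kCore G 2 := by
  refine subset_kCore (S := kCore G 2 ∪ {x | x ∈ p.support}) (fun y hy => ?_) (Or.inr hx)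
  by_cases hyc : y ∈ kCore G 2
  · exact (le_card_of_mem_kCore hyc).trans
      (card_inter_neighbors_mono G Set.subset_union_left y)
  · obtain ⟨i, rfl, hi⟩ :=
      SimpleGraph.Walk.mem_support_iff_exists_getVert.1 (hy.resolve_left hyc)
    have hi0 : i ≠ 0 := by rintro rfl; exact hyc (by simpa using hu)
    have hil : i ≠ p.length := by rintro rfl; exact hyc (by simpa using hv)
    have h1 := p.adj_getVert_succ (i := i - 1) (by omega)
    have h2 := p.adj_getVert_succ (i := i) (by omega)
    rw [Nat.sub_add_cancel (Nat.pos_of_ne_zero hi0)] at h1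
    have hne : p.getVert (i - 1) ≠ p.getVert (i + 1) := fun h => by
      have := hp.getVert_injOn (show i - 1 ≤ p.length by omega)
        (show i + 1 ≤ p.length by omega) h
      omega
    refine (Set.ncard_pair hne).ge.trans ?_
    refine Nat.card_mono (Set.toFinite
      {u | u ∈ kCore G 2 ∪ {x | x ∈ p.support} ∧ G.Adj (p.getVert i) u}) ?_
    rintro z (rfl | rfl)
    · exact ⟨Or.inr (p.getVert_mem_support _), h1.symm⟩
    · exact ⟨Or.inr (p.getVert_mem_support _), h2⟩

/-- Deleting `V23 G` from a connected graph leaves a forest. -/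
theorem eq_empty_of_disjoint_V23 {V : Type*} [Finite V] {G : SimpleGraph V}
    (hconn : G.Connected) (hne : (V23 G).Nonempty) {S : Set V} (hdisj : ∀ v ∈ S, v ∉ V23 G)
    (hS : ∀ v ∈ S, 2 ≤ Nat.card {u // u ∈ S ∧ G.Adj v u}) : S = ∅ := by
  by_contra hne'
  obtain ⟨s, hs⟩ := Set.nonempty_iff_ne_empty.2 hne'
  obtain ⟨v, hv⟩ := hne
  have hcore := subset_kCore hS
  obtain ⟨p, hp⟩ := (hconn.preconnected s v).exists_isPath
  have hclosed {x y : V} (hx : x ∈ S) (hy : y ∈ kCore G 2) (hxy : G.Adj x y) : y ∈ S := by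
    have hlt : Nat.card {u // u ∈ kCore G 2 ∧ G.Adj x u} < 3 := by
      by_contra! h
      exact hdisj x hx ⟨hcore hx, h⟩
    have heq : {u | u ∈ S ∧ G.Adj x u} = {u | u ∈ kCore G 2 ∧ G.Adj x u} :=
      Set.eq_of_subset_of_ncard_le (fun u hu => ⟨hcore hu.1, hu.2⟩)
        ((Nat.le_of_lt_succ hlt).trans (hS x hx)) (Set.toFinite _)
    have : y ∈ {u | u ∈ S ∧ G.Adj x u} := heq ▸ ⟨hy, hxy⟩
    exact this.1
  have hall : ∀ i ≤ p.length, p.getVert i ∈ S := by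
    intro i
    induction i with
    | zero => intro _; simpa using hs
    | succ i ih =>
      intro hi
      exact hclosed (ih (by omega))
        (mem_kCore_two_of_mem_support p hp (hcore hs) hv.1 (p.getVert_mem_support _))
        (p.adj_getVert_succ (by omega))
  exact hdisj v (by simpa using hall p.length le_rfl) hv

theorem CrossEquitable.mem_kCore_of_eq {V C : Type*} [Finite V] {G : SimpleGraph V} {c : V → C}
    (hGG : CrossEquitable G G c c) {k : ℕ} {u v : V} (hv : v ∈ kCore G k) (huv : c u = c v) :
    u ∈ kCore G k := by
  refine subset_kCore (S := {x | c x ∈ c '' kCore G k}) ?_ ⟨v, hv, huv.symm⟩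
  rintro x ⟨y, hy, hyx⟩
  have h := hGG x y hyx.symm (c '' kCore G k)
  simp only [and_comm (a := G.Adj _ _)] at h
  exact ((le_card_of_mem_kCore hy).trans
    (card_inter_neighbors_mono G (Set.subset_preimage_image c _) y)).trans h.ge

theorem CrossEquitable.mem_V23_of_eq {V C : Type*} [Finite V] {G : SimpleGraph V} {c : V → C}
    (hGG : CrossEquitable G G c c) {u v : V} (hv : v ∈ V23 G) (huv : c u = c v) :
    u ∈ V23 G := by
  have hu := hGG.mem_kCore_of_eq hv.1 huv
  have hsat (x : V) : c x ∈ c '' kCore G 2 ↔ x ∈ kCore G 2 :=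
    ⟨fun ⟨y, hy, hyx⟩ => hGG.mem_kCore_of_eq hy hyx.symm, Set.mem_image_of_mem c⟩
  have h := hGG u v huv (c '' kCore G 2)
  simp only [and_comm (a := G.Adj _ _), hsat] at h
  exact ⟨hu, hv.2.trans h.ge⟩

theorem adj_iff_card_ne_zero {V C : Type*} [Finite V] (G : SimpleGraph V) {c : V → C} {u : V}
    (hu : ∀ x, c x = c u → x = u) (v : V) :
    G.Adj v u ↔ Nat.card {x // G.Adj v x ∧ c x ∈ ({c u} : Set C)} ≠ 0 := by
  rw [Nat.card_ne_zero]
  constructor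
  · exact fun h => ⟨⟨u, h, rfl⟩, inferInstance⟩
  · rintro ⟨⟨x, hx, hxu⟩, -⟩
    exact hu x hxu ▸ hx

theorem CrossEquitable.nonempty_iso {V W C : Type*} [Finite V] [Finite W] {G : SimpleGraph V}
    {H : SimpleGraph W} {c : V → C} {d : W → C} (hGG : CrossEquitable G G c c)
    (hGH : CrossEquitable G H c d)
    (hsize : ∀ a, Nat.card {v // c v = a} = Nat.card {w // d w = a})
    (hconn : G.Connected) (hne : (V23 G).Nonempty) (hinj : Set.InjOn c (V23 G)) :
    Nonempty (G ≃g H) := by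
  classical
  obtain ⟨E, hE⟩ := hGH.exists_fiberwise_equiv hsize
    (Set.toFinite (Set.range c \ c '' V23 G)).toFinset
    fun S hS => eq_empty_of_disjoint_V23 hconn hne fun v hv hv' => by
      have := hS v hv
      simp only [Set.Finite.mem_toFinset] at this
      exact this.2 ⟨v, hv', rfl⟩
  let φ : V ≃ W := (Equiv.sigmaFiberEquiv c).symm.trans
    ((Equiv.sigmaCongrRight E).trans (Equiv.sigmaFiberEquiv d))
  have hdφ (v : V) : d (φ v) = c v := (E (c v) ⟨v, rfl⟩).2
  have hsing {u : V} (hu : c u ∈ c '' V23 G) (v : V) : G.Adj v u ↔ H.Adj (φ v) (φ u) := by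
    obtain ⟨u', hu', huu'⟩ := hu
    have huV := hGG.mem_V23_of_eq hu' huu'.symm
    have huniq : ∀ x, c x = c u → x = u := fun x hx =>
      hinj (hGG.mem_V23_of_eq huV hx) huV hx
    rw [adj_iff_card_ne_zero G huniq, adj_iff_card_ne_zero H (c := d), hdφ,
      hGH v (φ v) (hdφ v).symm]
    intro w hw
    obtain ⟨x, rfl⟩ := φ.surjective w
    rw [hdφ, hdφ] at hw
    rw [huniq x hw]
  refine ⟨⟨φ, fun {u v} => ?_⟩⟩
  by_cases hv : c v ∈ c '' V23 G
  · exact (hsing hv u).symm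
  by_cases hu : c u ∈ c '' V23 G
  · rw [G.adj_comm, H.adj_comm]
    exact (hsing hu v).symm
  exact (hE (c u) (by simpa using hu) (c v) (by simpa using hv) ⟨u, rfl⟩ ⟨v, rfl⟩).symm

theorem canonColor_eq_of_le {V W : Type*} [Fintype V] [Fintype W] {G : SimpleGraph V}
    {H : SimpleGraph W} {s t : ℕ} (hst : s ≤ t) {v : V} {w : W}
    (h : canonColor G t v = canonColor H t w) : canonColor G s v = canonColor H s w := by
  induction t, hst using Nat.le_induction with
  | base => exact h
  | succ t _ ih => exact ih (congrArg Prod.fst h)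

/-- Colour refinement stabilises: at some time beyond any given one, the colour of a vertex
determines its colour in the next round. -/
theorem exists_canonColor_stable {V : Type*} [Fintype V] (G : SimpleGraph V) (s : ℕ) :
    ∃ t ≥ s, ∀ u v, canonColor G t u = canonColor G t v →
      canonColor G (t + 1) u = canonColor G (t + 1) v := by
  by_contra! hcon
  have hmono : ∀ t ≥ s,
      (Set.range (canonColor G t)).ncard < (Set.range (canonColor G (t + 1))).ncard := by
    intro t ht
    let π : CCol (t + 1) → CCol t := Prod.fst
    have himg : Set.range (canonColor G t) = π '' Set.range (canonColor G (t + 1)) :=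
      Set.range_comp π (canonColor G (t + 1))
    refine lt_of_le_of_ne ?_ fun heq => ?_
    · rw [himg]
      exact Set.ncard_image_le (Set.finite_range _)
    · obtain ⟨u, v, huv, hne⟩ := hcon t ht
      rw [himg] at heq
      exact hne (Set.injOn_of_ncard_image_eq heq (Set.finite_range _) ⟨u, rfl⟩ ⟨v, rfl⟩ huv)
  have hgrow : ∀ k, k ≤ (Set.range (canonColor G (s + k))).ncard := by
    intro k
    induction k with
    | zero => exact Nat.zero_le _
    | succ k ih => exact ih.trans_lt (hmono (s + k) (by omega))
  have hle : (Set.range (canonColor G (s + (Fintype.card V + 1)))).ncard ≤ Fintype.card V := by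
    rw [← Set.image_univ, ← Nat.card_eq_fintype_card, ← Set.ncard_univ]
    exact Set.ncard_image_le Set.finite_univ
  have := hgrow (Fintype.card V + 1)
  omega

theorem crossEquitable_canonColor {V W : Type*} [Fintype V] [Fintype W] {G : SimpleGraph V}
    {H : SimpleGraph W} {t : ℕ} (h : ∀ v w, canonColor G t v = canonColor H t w →
      canonColor G (t + 1) v = canonColor H (t + 1) w) :
    CrossEquitable G H (canonColor G t) (canonColor H t) := by
  classical
  intro v w hvw Q
  have hm := congrArg (Multiset.countP (· ∈ Q)) (congrArg Prod.snd (h v w hvw))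
  simp only [canonColor, Multiset.countP_map] at hm
  rw [Nat.subtype_card (Finset.univ.filter fun x => G.Adj v x ∧ canonColor G t x ∈ Q) (by simp),
    Nat.subtype_card (Finset.univ.filter fun x => H.Adj w x ∧ canonColor H t x ∈ Q) (by simp)]
  rw [← Finset.filter_filter, ← Finset.filter_filter]
  convert hm using 1 <;> simp only [Finset.card, Finset.filter_val]

/-- Proposition 2.9.
Let `G` be a connected finite graph with `V_{2,3}(G) ≠ ∅` whose canonical stable colouring is
injective on `V_{2,3}(G)`. Then `G` is CR-determined: any graph `H` on the same number of
vertices whose multiset of canonical colours agrees with that of `G` at every time `t` is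
isomorphic to `G`. -/
theorem stmt10 {V W : Type*} [Fintype V] [Fintype W] (G : SimpleGraph V)
    (hconn : G.Connected) (hne : (V23 G).Nonempty)
    (hinj : ∀ u ∈ V23 G, ∀ v ∈ V23 G,
      canonColor G (Fintype.card V) u = canonColor G (Fintype.card V) v → u = v)
    (H : SimpleGraph W) (hcard : Fintype.card W = Fintype.card V)
    (hcols : ∀ t : ℕ,
      Finset.univ.val.map (canonColor G t) = Finset.univ.val.map (canonColor H t)) :
    Nonempty (G ≃g H) := by
  classical
  obtain ⟨t, ht, hstab⟩ := exists_canonColor_stable G (Fintype.card V)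
  have hcolor (s : ℕ) (w : W) : ∃ v, canonColor G s v = canonColor H s w := by
    have hw : canonColor H s w ∈ Finset.univ.val.map (canonColor H s) :=
      Multiset.mem_map_of_mem _ (Finset.mem_univ w)
    rw [← hcols s] at hw
    obtain ⟨v, -, hv⟩ := Multiset.mem_map.1 hw
    exact ⟨v, hv⟩
  have hcross : ∀ v w, canonColor G t v = canonColor H t w →
      canonColor G (t + 1) v = canonColor H (t + 1) w := by
    intro v w hvw
    obtain ⟨u, hu⟩ := hcolor (t + 1) w
    rw [← hu]
    exact hstab v u (hvw.trans (congrArg Prod.fst hu).symm)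
  refine (crossEquitable_canonColor hstab).nonempty_iso (crossEquitable_canonColor hcross)
    (fun a => ?_) hconn hne
    fun u hu v hv huv => hinj u hu v hv (canonColor_eq_of_le ht huv)
  have hm := congrArg (Multiset.countP (· = a)) (hcols t)
  simp only [Multiset.countP_map] at hm
  rw [Nat.subtype_card (Finset.univ.filter fun x => canonColor G t x = a) (by simp),
    Nat.subtype_card (Finset.univ.filter fun x => canonColor H t x = a) (by simp)]
  convert hm using 1 <;> simp only [Finset.card, Finset.filter_val]
end

section
/- Let H be an n-vertex graph and c : V(H) → Ω an equitable colouring. Let c' be a random refinement of c, obtained by independently, for each vertex, assigning it a new colour unique to that vertex with probability at least 0.7 (and otherwise keeping its colour under c). Then with high probability (uniformly over all choices of H, c and the individual recolouring probabilities) the following two properties both hold: (1) every connected component of D(H,c) with at least log n vertices can be partitioned into colour classes of R*c'; and (2) for every colour class C of c and every connected component X of D(H,c), every connected component of D(H, R*c') that intersects C ∩ X has at most 5·|C ∩ X| + 5·log n vertices. -/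
open MeasureTheory Filter

open Classical in
/-- `r` is an equivalence relation such that equivalent vertices have equally many neighbours in
every equivalence class. -/
def IsStableRel {V : Type*} [Fintype V] (G : SimpleGraph V) (r : V → V → Prop) : Prop :=
  Equivalence r ∧ ∀ u v, r u v → ∀ w,
    (Finset.univ.filter fun x => G.Adj u x ∧ r x w).card =
      (Finset.univ.filter fun x => G.Adj v x ∧ r x w).card

theorem crEquiv_equivalence {V Ω : Type*} (G : SimpleGraph V) (c : V → Ω) (t : ℕ) :
    Equivalence (crEquiv G c t) := by
  induction t with
  | zero => exact ⟨fun _ => rfl, fun h => Eq.symm h, fun h h' => Eq.trans h h'⟩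
  | succ t ih =>
    exact ⟨fun u => ⟨ih.refl u, fun _ => rfl⟩, fun h => ⟨ih.symm h.1, fun w => (h.2 w).symm⟩,
      fun h h' => ⟨ih.trans h.1 h'.1, fun w => (h.2 w).trans (h'.2 w)⟩⟩

theorem crEquiv_antitone {V Ω : Type*} (G : SimpleGraph V) (c : V → Ω) {s t : ℕ} (h : s ≤ t)
    {u v : V} (huv : crEquiv G c t u v) : crEquiv G c s u v := by
  induction h with
  | refl => exact huv
  | step _ ih => exact ih huv.1

theorem exists_crEquiv_imp_crStable {V Ω : Type*} [Finite V] (G : SimpleGraph V) (c : V → Ω) :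
    ∃ t, ∀ u v, crEquiv G c t u v → crStable G c u v := by
  classical
  have := Fintype.ofFinite V
  have h : ∀ p : V × V, ∃ t, crEquiv G c t p.1 p.2 → crStable G c p.1 p.2 := by
    intro p
    by_cases hp : crStable G c p.1 p.2
    · exact ⟨0, fun _ => hp⟩
    · obtain ⟨t, ht⟩ := not_forall.1 hp
      exact ⟨t, fun h => absurd h ht⟩
  choose T hT using h
  exact ⟨Finset.univ.sup T, fun u v huv =>
    hT (u, v) (crEquiv_antitone G c (Finset.le_sup (Finset.mem_univ _)) huv)⟩

theorem crStable_isStableRel {V Ω : Type*} [Fintype V] (G : SimpleGraph V) (c : V → Ω) :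
    IsStableRel G (crStable G c) := by
  classical
  obtain ⟨t, ht⟩ := exists_crEquiv_imp_crStable G c
  have hE : ∀ x w, crEquiv G c t x w ↔ crStable G c x w := fun x w => ⟨ht x w, fun h => h t⟩
  refine ⟨⟨fun u t => (crEquiv_equivalence G c t).refl u,
    fun h t => (crEquiv_equivalence G c t).symm (h t),
    fun h h' t => (crEquiv_equivalence G c t).trans (h t) (h' t)⟩, fun u v huv w => ?_⟩
  have := (huv (t + 1)).2 w
  simpa only [hE, Nat.card_eq_fintype_card, Fintype.card_subtype] using this

theorem crStable_initial {V Ω : Type*} {G : SimpleGraph V} {c : V → Ω} {u v : V}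
    (h : crStable G c u v) : c u = c v := h 0

theorem IsStableRel.card_congr {V : Type*} [Fintype V] {G : SimpleGraph V} {r : V → V → Prop}
    (hr : IsStableRel G r) {p : V → Prop} [DecidablePred p] [DecidableRel G.Adj]
    (hp : ∀ x y, r x y → p x → p y)
    {u v : V} (huv : r u v) :
    (Finset.univ.filter fun x => G.Adj u x ∧ p x).card =
      (Finset.univ.filter fun x => G.Adj v x ∧ p x).card := by
  classical
  let S : Setoid V := ⟨r, hr.1⟩
  have key : ∀ a : V, (Finset.univ.filter fun x => G.Adj a x ∧ p x).card =
      ∑ b : Quotient S, ((Finset.univ.filter fun x => G.Adj a x ∧ p x).filter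
        fun x => (Quotient.mk S x) = b).card := fun a =>
    Finset.card_eq_sum_card_fiberwise (fun _ _ => Finset.mem_coe.2 (Finset.mem_univ _))
  rw [key u, key v]
  refine Finset.sum_congr rfl fun b _ => ?_
  induction b using Quotient.inductionOn with
  | _ w =>
    by_cases hw : p w
    · have h := hr.2 u v huv w
      have e : ∀ a : V, ((Finset.univ.filter fun x => G.Adj a x ∧ p x).filter
          fun x => (Quotient.mk S x) = Quotient.mk S w) =
          Finset.univ.filter fun x => G.Adj a x ∧ r x w := by
        intro a
        ext x
        simp only [Finset.mem_filter, Finset.mem_univ, true_and]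
        constructor
        · rintro ⟨⟨h1, _⟩, h2⟩
          exact ⟨h1, Quotient.exact h2⟩
        · rintro ⟨h1, h2⟩
          exact ⟨⟨h1, hp _ _ (hr.1.symm h2) hw⟩, Quotient.sound h2⟩
      rw [e u, e v]
      convert h
    · have e : ∀ a : V, ((Finset.univ.filter fun x => G.Adj a x ∧ p x).filter
          fun x => (Quotient.mk S x) = Quotient.mk S w) = ∅ := by
        intro a
        refine Finset.filter_eq_empty_iff.2 fun x hx h2 => hw ?_
        exact hp _ _ (show r x w from Quotient.exact h2) (Finset.mem_filter.1 hx).2.2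
      rw [e u, e v]

/-- The stable colouring is the coarsest stable refinement of the initial colouring. -/
theorem IsStableRel.crStable {V Ω : Type*} [Fintype V] {G : SimpleGraph V} {c : V → Ω}
    {r : V → V → Prop} (hr : IsStableRel G r) (hc : ∀ u v, r u v → c u = c v) {u v : V}
    (huv : r u v) : crStable G c u v := by
  classical
  intro t
  induction t generalizing u v with
  | zero => exact hc u v huv
  | succ t ih =>
    refine ⟨ih huv, fun w => ?_⟩
    simp only [Nat.card_eq_fintype_card, Fintype.card_subtype]
    exact hr.card_congr
      (fun x y hxy hx =>
        (crEquiv_equivalence G c t).trans ((crEquiv_equivalence G c t).symm (ih hxy)) hx) huv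

section Individualization

open Classical

/-- The stable colouring obtained from the colouring by `c` and membership in `X` after
individualising the vertices in `E`. -/
def individualizedRel {V Ω : Type*} (G : SimpleGraph V) (c : V → Ω) (X : Set V)
    (E : Finset V) : V → V → Prop :=
  crStable G (refineColor (fun v => (c v, v ∈ X)) fun v => decide (v ∈ E))

variable {V Ω : Type*} {G : SimpleGraph V} {c : V → Ω} {X : Set V}

theorem individualizedRel.color_eq {E : Finset V} {u v : V} (h : individualizedRel G c X E u v) :
    c u = c v ∧ (u ∈ X ↔ v ∈ X) := by
  have := crStable_initial h
  unfold refineColor at this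
  split_ifs at this with h1 h2
  · have e : u = v := by simpa using this
    simp [e]
  · simpa using this

theorem individualizedRel.eq_of_mem {E : Finset V} {u v : V} (hv : v ∈ E)
    (h : individualizedRel G c X E u v) : u = v := by
  have := crStable_initial h
  unfold refineColor at this
  split_ifs at this with h1 h2
  · simpa using this
  · simp_all

theorem crStable_refineColor_eq {f : V → Bool} {u v : V} (hv : f v = true)
    (h : crStable G (refineColor c f) u v) : u = v := by
  have := crStable_initial h
  unfold refineColor at this
  split_ifs at this
  simpa using this

theorem crStable_refineColor_color_eq {f : V → Bool} {u v : V}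
    (h : crStable G (refineColor c f) u v) : c u = c v := by
  have := crStable_initial h
  unfold refineColor at this
  split_ifs at this with h1 h2
  · have e : u = v := by simpa using this
    rw [e]
  · simpa using this

end Individualization

section Disparity

open Classical

variable {V : Type*} [Fintype V] {G : SimpleGraph V} {r : V → V → Prop}

theorem IsStableRel.card_ne_congr (hr : IsStableRel G r) {u v : V} (huv : r u v) (w : V) :
    (Finset.univ.filter fun x => x ≠ u ∧ r x w).card =
      (Finset.univ.filter fun x => x ≠ v ∧ r x w).card := by
  have e : ∀ a : V, (Finset.univ.filter fun x => x ≠ a ∧ r x w) =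
      (Finset.univ.filter fun x => r x w).erase a := by
    intro a; ext x; simp
  rw [e u, e v, Finset.card_erase_eq_ite, Finset.card_erase_eq_ite]
  have : r u w ↔ r v w := ⟨hr.1.trans (hr.1.symm huv), hr.1.trans huv⟩
  simp [this]

theorem card_filter_prod_eq {α β : Type*} [Fintype α] [Fintype β] (P : α → Prop)
    (Q : α → β → Prop) (k : ℕ)
    (h : ∀ a, P a → (Finset.univ.filter fun b => Q a b).card = k) :
    (Finset.univ.filter fun p : α × β => P p.1 ∧ Q p.1 p.2).card =
      (Finset.univ.filter fun a => P a).card * k := by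
  rw [Finset.card_filter, ← Finset.univ_product_univ, Finset.sum_product, Finset.card_filter,
    Finset.sum_mul]
  refine Finset.sum_congr rfl fun a _ => ?_
  by_cases ha : P a
  · simp [ha, ← h a ha]
  · simp [ha]

theorem IsStableRel.majority_iff (hr : IsStableRel G r) (u v : V) :
    majority G r u v ↔ (Finset.univ.filter fun x => x ≠ u ∧ r x v).card ≤
      2 * (Finset.univ.filter fun x => G.Adj u x ∧ r x v).card := by
  have h1 : (Finset.univ.filter fun p : V × V => r p.1 u ∧ p.2 ≠ p.1 ∧ r p.2 v).card =
      (Finset.univ.filter fun a => r a u).card *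
        (Finset.univ.filter fun x => x ≠ u ∧ r x v).card := by
    convert card_filter_prod_eq (fun a => r a u) (fun a b => b ≠ a ∧ r b v) _ fun a ha => ?_
    convert hr.card_ne_congr ha v
  have h2 : (Finset.univ.filter fun p : V × V => r p.1 u ∧ G.Adj p.1 p.2 ∧ r p.2 v).card =
      (Finset.univ.filter fun a => r a u).card *
        (Finset.univ.filter fun x => G.Adj u x ∧ r x v).card := by
    convert card_filter_prod_eq (fun a => r a u) (fun a b => G.Adj a b ∧ r b v) _ fun a ha => ?_
    convert hr.2 a u ha v
  have hpos : 0 < (Finset.univ.filter fun a => r a u).card :=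
    Finset.card_pos.2 ⟨u, by simp [hr.1.refl u]⟩
  unfold majority
  simp only [Nat.card_eq_fintype_card, Fintype.card_subtype]
  have e1 : (Finset.univ.filter fun p : V × V => p.1 ≠ p.2 ∧ r p.1 u ∧ r p.2 v) =
      Finset.univ.filter fun p : V × V => r p.1 u ∧ p.2 ≠ p.1 ∧ r p.2 v := by
    ext p; simp only [Finset.mem_filter, Finset.mem_univ, true_and]; tauto
  have e2 : (Finset.univ.filter fun p : V × V => p.1 ≠ p.2 ∧ r p.1 u ∧ r p.2 v ∧ G.Adj p.1 p.2) =
      Finset.univ.filter fun p : V × V => r p.1 u ∧ G.Adj p.1 p.2 ∧ r p.2 v := by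
    ext p; simp only [Finset.mem_filter, Finset.mem_univ, true_and]
    constructor
    · tauto
    · rintro ⟨a, b, c⟩; exact ⟨b.ne, a, c, b⟩
  rw [e1, e2, h1, h2, mul_left_comm]
  exact Nat.mul_le_mul_left_iff hpos

theorem majority_comm {V : Type*} (G : SimpleGraph V) (r : V → V → Prop) (u v : V) :
    majority G r u v ↔ majority G r v u := by
  have h1 : Nat.card {p : V × V // p.1 ≠ p.2 ∧ r p.1 u ∧ r p.2 v} =
      Nat.card {p : V × V // p.1 ≠ p.2 ∧ r p.1 v ∧ r p.2 u} :=
    Nat.card_congr ((Equiv.prodComm V V).subtypeEquiv fun p => by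
      simp only [Equiv.prodComm_apply, Prod.fst_swap, Prod.snd_swap]; tauto)
  have h2 : Nat.card {p : V × V // p.1 ≠ p.2 ∧ r p.1 u ∧ r p.2 v ∧ G.Adj p.1 p.2} =
      Nat.card {p : V × V // p.1 ≠ p.2 ∧ r p.1 v ∧ r p.2 u ∧ G.Adj p.1 p.2} :=
    Nat.card_congr ((Equiv.prodComm V V).subtypeEquiv fun p => by
      simp only [Equiv.prodComm_apply, Prod.fst_swap, Prod.snd_swap, G.adj_comm p.2 p.1]; tauto)
  unfold majority
  rw [h1, h2]

theorem majority_congr {V : Type*} {G : SimpleGraph V} {r : V → V → Prop} (hr : Equivalence r)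
    {u u' v v' : V} (hu : r u u') (hv : r v v') : majority G r u v ↔ majority G r u' v' := by
  have e1 : ∀ x, r x u ↔ r x u' := fun x =>
    ⟨fun h => hr.trans h hu, fun h => hr.trans h (hr.symm hu)⟩
  have e2 : ∀ x, r x v ↔ r x v' := fun x =>
    ⟨fun h => hr.trans h hv, fun h => hr.trans h (hr.symm hv)⟩
  simp only [majority, e1, e2]

theorem disparity_adj {V : Type*} {G : SimpleGraph V} {r : V → V → Prop} {u v : V} :
    (disparity G r).Adj u v ↔ u ≠ v ∧ (G.Adj u v ↔ ¬ majority G r u v) := by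
  rw [disparity, SimpleGraph.fromRel_adj, G.adj_comm v u, majority_comm G r v u, or_self]
  exact and_congr_right fun _ => xor_iff_iff_not

theorem IsStableRel.exists_adj_iff_not (hr : IsStableRel G r) {u w : V}
    (h : (disparity G r).Adj u w) :
    ∃ x, r x w ∧ x ≠ u ∧ (G.Adj u x ↔ ¬ G.Adj u w) := by
  obtain ⟨hne, h⟩ := disparity_adj.1 h
  have hm := hr.majority_iff u w
  by_cases ha : G.Adj u w
  · have hlt := not_le.1 (hm.not.1 (h.1 ha))
    have : ¬ (Finset.univ.filter fun x => x ≠ u ∧ r x w) ⊆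
        Finset.univ.filter fun x => G.Adj u x ∧ r x w := fun hs => by
      have := Finset.card_le_card hs
      omega
    obtain ⟨x, hx, hx'⟩ := Finset.not_subset.1 this
    simp only [Finset.mem_filter, Finset.mem_univ, true_and] at hx hx'
    exact ⟨x, hx.2, hx.1, by tauto⟩
  · have hle := hm.1 (not_not.1 fun h' => ha (h.2 h'))
    have : 0 < (Finset.univ.filter fun x => x ≠ u ∧ r x w).card :=
      Finset.card_pos.2 ⟨w, by simp [hr.1.refl w, hne.symm]⟩
    obtain ⟨x, hx⟩ := Finset.card_pos.1
      (show 0 < (Finset.univ.filter fun x => G.Adj u x ∧ r x w).card by omega)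
    simp only [Finset.mem_filter, Finset.mem_univ, true_and] at hx
    exact ⟨x, hx.2, hx.1.ne', by tauto⟩

variable {s : V → V → Prop}

theorem IsStableRel.exists_disparity_adj (hr : IsStableRel G r) (hs : Equivalence s)
    (hrs : ∀ x y, r x y → s x y) {x y x' : V} (hxy : r x y) (h : (disparity G s).Adj x x') :
    ∃ y', (disparity G s).Adj y y' ∧ r x' y' := by
  obtain ⟨hne, h⟩ := disparity_adj.1 h
  have hd := hr.2 x y hxy x'
  have hm := hr.card_ne_congr hxy x'
  by_cases ha : G.Adj x x'
  · have : 0 < (Finset.univ.filter fun z => G.Adj x z ∧ r z x').card :=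
      Finset.card_pos.2 ⟨x', by simp [hr.1.refl x', ha]⟩
    obtain ⟨y', hy'⟩ := Finset.card_pos.1 (hd ▸ this)
    simp only [Finset.mem_filter, Finset.mem_univ, true_and] at hy'
    have hmaj := majority_congr (G := G) hs (hrs _ _ hxy) (hrs _ _ (hr.1.symm hy'.2))
    exact ⟨y', disparity_adj.2 ⟨hy'.1.ne, by tauto⟩, hr.1.symm hy'.2⟩
  · have hlt : (Finset.univ.filter fun z => G.Adj x z ∧ r z x').card <
        (Finset.univ.filter fun z => z ≠ x ∧ r z x').card := by
      refine Finset.card_lt_card ⟨fun z hz => ?_, fun hz => ?_⟩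
      · simp only [Finset.mem_filter, Finset.mem_univ, true_and] at hz ⊢
        exact ⟨hz.1.ne', hz.2⟩
      · have := hz (show x' ∈ _ by simp [hr.1.refl x', hne.symm])
        simp only [Finset.mem_filter, Finset.mem_univ, true_and] at this
        exact ha this.1
    have : ¬ (Finset.univ.filter fun z => z ≠ y ∧ r z x') ⊆
        Finset.univ.filter fun z => G.Adj y z ∧ r z x' := fun hs => by
      have := Finset.card_le_card hs
      omega
    obtain ⟨y', hy, hy'⟩ := Finset.not_subset.1 this
    simp only [Finset.mem_filter, Finset.mem_univ, true_and] at hy hy'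
    have hmaj := majority_congr (G := G) hs (hrs _ _ hxy) (hrs _ _ (hr.1.symm hy.2))
    exact ⟨y', disparity_adj.2 ⟨hy.1.symm, by tauto⟩, hr.1.symm hy.2⟩

/-- Components of the disparity graph of a coarser colouring that share a class of a stable
relation meet the same classes of that relation. -/
theorem IsStableRel.exists_reachable (hr : IsStableRel G r) (hs : Equivalence s)
    (hrs : ∀ x y, r x y → s x y) {x y x' : V} (hxy : r x y)
    (h : (disparity G s).Reachable x x') :
    ∃ y', (disparity G s).Reachable y y' ∧ r x' y' := by
  obtain ⟨p⟩ := h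
  induction p generalizing y with
  | nil => exact ⟨y, .refl _, hxy⟩
  | cons ha _ ih =>
    obtain ⟨z, hz, hz'⟩ := hr.exists_disparity_adj hs hrs hxy ha
    obtain ⟨y', hy', h⟩ := ih hz'
    exact ⟨y', hz.reachable.trans hy', h⟩

/-- If the majority bits of a pair of classes differ between a stable relation and a coarser one,
then every component of the coarser disparity graph meeting the first class contains at least
half of the second one. -/
theorem IsStableRel.card_class_le (hr : IsStableRel G r) (hs : Equivalence s)
    (hrs : ∀ x y, r x y → s x y) {u w : V}
    (h : majority G r u w ↔ ¬ majority G s u w) :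
    (Finset.univ.filter fun x => r x w).card ≤
      2 * (Finset.univ.filter fun x => r x w ∧ (disparity G s).Reachable u x).card := by
  have hm := hr.majority_iff u w
  have hadj : ∀ x, r x w → x ≠ u →
      ((disparity G s).Adj u x ↔ (G.Adj u x ↔ ¬ majority G s u w)) := by
    intro x hx hxu
    rw [disparity_adj, majority_congr hs (hs.refl u) (hrs _ _ hx)]
    simp [hxu.symm]
  have hsub : (Finset.univ.filter fun x => G.Adj u x ∧ r x w) ⊆
      Finset.univ.filter fun x => x ≠ u ∧ r x w := fun z hz => by
    simp only [Finset.mem_filter, Finset.mem_univ, true_and] at hz ⊢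
    exact ⟨hz.1.ne', hz.2⟩
  have key : (Finset.univ.filter fun x => x ≠ u ∧ r x w).card ≤
      2 * (Finset.univ.filter fun x => r x w ∧ (disparity G s).Adj u x).card := by
    by_cases hms : majority G s u w
    · have e : (Finset.univ.filter fun x => r x w ∧ (disparity G s).Adj u x) =
          (Finset.univ.filter fun x => x ≠ u ∧ r x w) \
            Finset.univ.filter fun x => G.Adj u x ∧ r x w := by
        ext x
        simp only [Finset.mem_filter, Finset.mem_univ, true_and, Finset.mem_sdiff]
        constructor
        · rintro ⟨h1, h2⟩
          have := (hadj x h1 h2.ne').1 h2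
          exact ⟨⟨h2.ne', h1⟩, by tauto⟩
        · rintro ⟨⟨h1, h2⟩, h3⟩
          exact ⟨h2, (hadj x h2 h1).2 (by tauto)⟩
      rw [e, Finset.card_sdiff_of_subset hsub]
      have : ¬ majority G r u w := by tauto
      have := not_le.1 (hm.not.1 this)
      omega
    · have : majority G r u w := by tauto
      refine (hm.1 this).trans (Nat.mul_le_mul_left 2 (Finset.card_le_card fun x hx => ?_))
      simp only [Finset.mem_filter, Finset.mem_univ, true_and] at hx ⊢
      exact ⟨hx.2, (hadj x hx.2 hx.1.ne').2 (by tauto)⟩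
  have hle : (Finset.univ.filter fun x => r x w ∧ (disparity G s).Adj u x) ⊆
      (Finset.univ.filter fun x => r x w ∧ (disparity G s).Reachable u x).erase u := by
    intro x hx
    simp only [Finset.mem_filter, Finset.mem_univ, true_and, Finset.mem_erase] at hx ⊢
    exact ⟨hx.2.ne', hx.1, hx.2.reachable⟩
  have hle' := Finset.card_le_card hle
  have e : (Finset.univ.filter fun x => x ≠ u ∧ r x w) =
      (Finset.univ.filter fun x => r x w).erase u := by ext x; simp
  rw [e] at key
  by_cases hu : r u w
  · have hu1 : u ∈ Finset.univ.filter fun x => r x w := by simp [hu]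
    have hu2 : u ∈ Finset.univ.filter fun x => r x w ∧ (disparity G s).Reachable u x := by
      simp [hu]
    rw [Finset.card_erase_of_mem hu1] at key
    rw [Finset.card_erase_of_mem hu2] at hle'
    have := Finset.card_pos.2 ⟨_, hu2⟩
    omega
  · rw [Finset.erase_eq_of_notMem (by simpa using hu)] at key
    have := hle'.trans (Finset.card_erase_le)
    omega

theorem compSet_subset {V : Type*} {G : SimpleGraph V} {S : Set V} {z : V} (hz : z ∈ S)
    (h : ∀ a ∈ S, ∀ b, G.Adj a b → b ∈ S) : compSet G z ⊆ S := by
  rintro y ⟨p⟩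
  induction p with
  | nil => exact hz
  | cons ha _ ih => exact ih (h _ hz _ ha)

/-- If every large component of the coarser disparity graph is a union of classes of a stable
relation, then a component of the finer disparity graph meeting a small component of the coarser
one is covered by two small components. -/
theorem IsStableRel.card_compSet_le (hr : IsStableRel G r) (hs : Equivalence s)
    (hrs : ∀ x y, r x y → s x y) {L : ℝ}
    (hgood : ∀ v, L ≤ Nat.card (compSet (disparity G s) v) → ∀ x ∈ compSet (disparity G s) v,
      ∀ y, r x y → y ∈ compSet (disparity G s) v) {z : V}
    (hz : (Nat.card (compSet (disparity G s) z) : ℝ) < L) :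
    (Nat.card (compSet (disparity G r) z) : ℝ) ≤ 2 * L := by
  set D := disparity G s with hD
  by_cases hcl : ∀ a ∈ compSet D z, ∀ b, (disparity G r).Adj a b → b ∈ compSet D z
  · have hsub := compSet_subset (show z ∈ compSet D z from .refl z) hcl
    have : (Nat.card (compSet (disparity G r) z) : ℝ) ≤ Nat.card (compSet D z) := by
      exact_mod_cast Nat.card_mono (Set.toFinite _) hsub
    linarith
  push Not at hcl
  obtain ⟨u, hu, w, huw, hw⟩ := hcl
  have hmaj : ∀ {a b}, (disparity G r).Adj a b → ¬ D.Adj a b →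
      (majority G r a b ↔ ¬ majority G s a b) := by
    intro a b h1 h2
    rw [hD, disparity_adj] at h2
    rw [disparity_adj] at h1
    tauto
  have hex : ∀ {a b}, (majority G r a b ↔ ¬ majority G s a b) →
      ∃ b', r b' b ∧ D.Reachable a b' := by
    intro a b h
    have h1 := hr.card_class_le hs hrs h
    have : 0 < (Finset.univ.filter fun x => r x b).card :=
      Finset.card_pos.2 ⟨b, by simp [hr.1.refl b]⟩
    obtain ⟨b', hb'⟩ := Finset.card_pos.1 (show 0 < (Finset.univ.filter fun x =>
      r x b ∧ (disparity G s).Reachable a x).card by omega)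
    exact ⟨b', by simpa using hb'⟩
  have huw_maj := hmaj huw fun h => hw (hu.trans h.reachable)
  obtain ⟨u', hu', hwu'⟩ := hex
    (hmaj huw.symm fun h => hw (hu.trans h.symm.reachable))
  have hu'w_maj : majority G r u' w ↔ ¬ majority G s u' w := by
    rw [majority_congr hr.1 hu' (hr.1.refl w), majority_congr hs (hrs _ _ hu') (hs.refl w)]
    exact huw_maj
  have h1 := hr.card_class_le hs hrs huw_maj
  have h2 := hr.card_class_le hs hrs hu'w_maj
  have hdisj : Disjoint (Finset.univ.filter fun x => r x w ∧ (disparity G s).Reachable u x)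
      (Finset.univ.filter fun x => r x w ∧ (disparity G s).Reachable u' x) := by
    rw [Finset.disjoint_left]
    intro x hx hx'
    simp only [Finset.mem_filter, Finset.mem_univ, true_and] at hx hx'
    exact hw ((hu.trans hx.2).trans (hx'.2.symm.trans hwu'.symm))
  have hcover : ∀ x, r x w → x ∈ compSet D z ∪ compSet D w := by
    have hsub : (Finset.univ.filter fun x => r x w ∧ (disparity G s).Reachable u x) ∪
        (Finset.univ.filter fun x => r x w ∧ (disparity G s).Reachable u' x) ⊆
        Finset.univ.filter fun x => r x w := by
      intro x hx
      simp only [Finset.mem_union, Finset.mem_filter, Finset.mem_univ, true_and] at hx ⊢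
      tauto
    have heq := Finset.eq_of_subset_of_card_le hsub (by
      rw [Finset.card_union_of_disjoint hdisj]; omega)
    intro x hx
    have : x ∈ Finset.univ.filter fun x => r x w := by simp [hx]
    rw [← heq] at this
    simp only [Finset.mem_union, Finset.mem_filter, Finset.mem_univ, true_and] at this
    rcases this with h | h
    · exact Or.inl (hu.trans h.2)
    · exact Or.inr (hwu'.trans h.2)
  have hclass : ∀ y ∈ compSet D z ∪ compSet D w, ∀ y', r y y' →
      y' ∈ compSet D z ∪ compSet D w := by
    intro y hy y' hyy'
    obtain ⟨x, hyx, hxw⟩ : ∃ x, D.Reachable y x ∧ r w x := by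
      rcases hy with hy | hy
      · obtain ⟨x, hx, hx'⟩ := hex huw_maj
        exact ⟨x, (show D.Reachable z y from hy).symm.trans (hu.trans hx'), hr.1.symm hx⟩
      · exact ⟨w, (show D.Reachable w y from hy).symm, hr.1.refl w⟩
    obtain ⟨x', hx', hxx'⟩ := hr.exists_reachable hs hrs hyy' hyx
    rcases hcover x' (hr.1.symm (hr.1.trans hxw hxx')) with h | h
    · exact Or.inl (SimpleGraph.Reachable.trans h hx'.symm)
    · exact Or.inr (SimpleGraph.Reachable.trans h hx'.symm)
  have hsub : compSet (disparity G r) z ⊆ compSet D z ∪ compSet D w := by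
    refine compSet_subset (Or.inl (.refl z)) fun a ha b hab => ?_
    by_cases hDab : D.Adj a b
    · rcases ha with h | h
      · exact Or.inl (SimpleGraph.Reachable.trans h hDab.reachable)
      · exact Or.inr (SimpleGraph.Reachable.trans h hDab.reachable)
    · obtain ⟨b', hb', hab'⟩ := hex (hmaj hab hDab)
      refine hclass b' ?_ b hb'
      rcases ha with h | h
      · exact Or.inl (SimpleGraph.Reachable.trans h hab')
      · exact Or.inr (SimpleGraph.Reachable.trans h hab')
  have hw_small : (Nat.card (compSet D w) : ℝ) < L := by
    by_contra hcon
    have := hgood w (not_lt.1 hcon) u' hwu' u hu'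
    exact hw (hu.trans (SimpleGraph.Reachable.symm this))
  have hcard : (Nat.card (compSet (disparity G r) z) : ℝ) ≤
      Nat.card (compSet D z) + Nat.card (compSet D w) := by
    have h1 := Nat.card_mono (Set.toFinite _) hsub
    have h2 := Set.ncard_union_le (compSet D z) (compSet D w)
    simp only [← Nat.card_coe_set_eq] at h2
    exact_mod_cast h1.trans h2
  linarith

/-- The number of classes of `r` that meet `A`. -/
noncomputable def numClasses {V : Type*} [Fintype V] (r : V → V → Prop) (A : Finset V) : ℕ :=
  (A.image fun x => Finset.univ.filter (r x)).card

theorem filter_class_eq_iff (hr : Equivalence r) {x y : V} :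
    Finset.univ.filter (r x) = Finset.univ.filter (r y) ↔ r x y := by
  constructor
  · intro h
    have : y ∈ Finset.univ.filter (r x) := by simp [h, hr.refl y]
    simpa using this
  · intro h
    ext w
    simpa using ⟨hr.trans (hr.symm h), hr.trans h⟩

theorem numClasses_mono_right {A B : Finset V} (h : A ⊆ B) : numClasses r A ≤ numClasses r B :=
  Finset.card_le_card (Finset.image_subset_image h)

theorem exists_image_class_eq (hr : Equivalence r) (hs : Equivalence s)
    (hrs : ∀ x y, r x y → s x y) (A : Finset V) :
    ∃ φ : Finset V → Finset V, (∀ x, φ (Finset.univ.filter (r x)) = Finset.univ.filter (s x)) ∧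
      (A.image fun x => Finset.univ.filter (s x)) =
        (A.image fun x => Finset.univ.filter (r x)).image φ := by
  refine ⟨fun C => Finset.univ.filter fun y => ∃ x ∈ C, s x y, fun x => ?_, ?_⟩
  · ext y
    simp only [Finset.mem_filter, Finset.mem_univ, true_and]
    exact ⟨fun ⟨w, hw, h⟩ => hs.trans (hrs _ _ hw) h, fun h => ⟨x, hr.refl x, h⟩⟩
  · rw [Finset.image_image]
    refine Finset.image_congr fun x _ => ?_
    ext y
    simp only [Finset.mem_filter, Finset.mem_univ, true_and, Function.comp]
    exact ⟨fun h => ⟨x, hr.refl x, h⟩, fun ⟨w, hw, h⟩ => hs.trans (hrs _ _ hw) h⟩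

theorem numClasses_lt (hr : Equivalence r) (hs : Equivalence s)
    (hrs : ∀ x y, r x y → s x y) {A : Finset V} {a b : V} (ha : a ∈ A) (hb : b ∈ A)
    (hab : s a b) (hab' : ¬ r a b) : numClasses s A < numClasses r A := by
  obtain ⟨φ, hφ, h⟩ := exists_image_class_eq hr hs hrs A
  unfold numClasses
  rw [h]
  refine lt_of_le_of_ne Finset.card_image_le fun heq => hab' ?_
  have := Finset.card_image_iff.1 heq (Finset.mem_coe.2 (Finset.mem_image_of_mem _ ha))
    (Finset.mem_coe.2 (Finset.mem_image_of_mem _ hb))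
    (by rw [hφ, hφ, filter_class_eq_iff hs]; exact hab)
  exact (filter_class_eq_iff hr).1 this

variable {Ω : Type*} {c : V → Ω} {X : Set V}

theorem individualizedRel_isStableRel (E : Finset V) :
    IsStableRel G (individualizedRel G c X E) := crStable_isStableRel _ _

theorem individualizedRel.mono {E E' : Finset V} (hE : E ⊆ E') {u v : V}
    (h : individualizedRel G c X E' u v) : individualizedRel G c X E u v := by
  refine (individualizedRel_isStableRel E').crStable (fun x y hxy => ?_) h
  by_cases hx : y ∈ E'
  · rw [hxy.eq_of_mem hx]
  · by_cases hy : x ∈ E'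
    · rw [((individualizedRel_isStableRel E').1.symm hxy).eq_of_mem hy]
    have hx' : y ∉ E := fun h => hx (hE h)
    have hy' : x ∉ E := fun h => hy (hE h)
    simpa [refineColor, hx', hy'] using hxy.color_eq

theorem crStable.individualizedRel {f : V → Bool} {E : Finset V} (hE : ∀ v ∈ E, f v = true)
    (hX : ∀ x ∈ X, ∀ y, crStable G (refineColor c f) x y → y ∈ X) {u v : V}
    (h : crStable G (refineColor c f) u v) : individualizedRel G c X E u v := by
  have hr := crStable_isStableRel G (refineColor c f)
  refine hr.crStable (fun x y hxy => ?_) h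
  by_cases hy : y ∈ E
  · rw [crStable_refineColor_eq (hE y hy) hxy]
  by_cases hx : x ∈ E
  · rw [crStable_refineColor_eq (hE x hx) (hr.1.symm hxy)]
  have : x ∈ X ↔ y ∈ X := ⟨fun h => hX x h y hxy, fun h => hX y h x (hr.1.symm hxy)⟩
  simpa [refineColor, hx, hy, this] using crStable_refineColor_color_eq hxy

/-- If individualising `x` splits no class inside `A`, then `x` is homogeneous towards every class
inside `A`. -/
theorem individualizedRel_of_numClasses_le {E A : Finset V} {x : V}
    (h : numClasses (individualizedRel G c X (insert x E)) A ≤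
      numClasses (individualizedRel G c X E) A) {a b : V} (ha : a ∈ A) (hb : b ∈ A)
    (hab : individualizedRel G c X E a b) : G.Adj x a ↔ G.Adj x b := by
  set r' := individualizedRel G c X (insert x E)
  have hr' : IsStableRel G r' := individualizedRel_isStableRel _
  have hr'ab : r' a b := by
    by_contra hcon
    exact absurd h (not_le.2 (numClasses_lt hr'.1 (individualizedRel_isStableRel E).1
      (fun _ _ => individualizedRel.mono (Finset.subset_insert x E)) ha hb hab hcon))
  have hc := hr'.2 a b hr'ab x
  have e : ∀ d, (Finset.univ.filter fun y => G.Adj d y ∧ r' y x) =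
      if G.Adj d x then {x} else ∅ := by
    intro d
    have hx : ∀ y, r' y x ↔ y = x := fun y =>
      ⟨fun h => h.eq_of_mem (Finset.mem_insert_self x E), fun h => h ▸ hr'.1.refl y⟩
    split_ifs with hd
    · ext y; simp only [hx, Finset.mem_filter, Finset.mem_univ, true_and, Finset.mem_singleton]
      exact ⟨fun h => h.2, fun h => ⟨h ▸ hd, h⟩⟩
    · ext y; simp only [hx, Finset.mem_filter, Finset.mem_univ, true_and, Finset.notMem_empty,
        iff_false]
      rintro ⟨h1, rfl⟩; exact hd h1
  rw [e, e] at hc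
  rw [G.adj_comm x a, G.adj_comm x b]
  split_ifs at hc with h1 h2 h2 <;> simp_all

/-- Once no further individualisation splits a class inside `W ∪ F`, where `W` is the set of
vertices of `X` with the colour of `z`, the disparity component of `z` is contained in classes
inside `F`. -/
theorem class_subset_of_numClasses_le {f : V → Bool} {E F W : Finset V} {z : V}
    (hE : ∀ v ∈ E, f v = true) (hX : ∀ x ∈ X, ∀ y, crStable G (refineColor c f) x y → y ∈ X)
    (hz : z ∈ X) (hW : ∀ x, c x = c z → x ∈ X → x ∈ W)
    (hstuck : ∀ x, x ∉ E → x ∉ F →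
      numClasses (individualizedRel G c X (insert x E)) (W ∪ F) ≤
        numClasses (individualizedRel G c X E) (W ∪ F))
    {u : V} (hu : (disparity G (crStable G (refineColor c f))).Adj z u) :
    ∀ y ∈ compSet (disparity G (crStable G (refineColor c f))) z,
      (∃ y', y' ≠ y ∧ individualizedRel G c X E y y') ∧
      ∀ x, individualizedRel G c X E y x → x ∈ F := by
  set R := crStable G (refineColor c f) with hRdef
  set P := individualizedRel G c X E with hPdef
  have hR : IsStableRel G R := crStable_isStableRel _ _
  have hP : IsStableRel G P := individualizedRel_isStableRel _
  have hRP : ∀ {x y}, R x y → P x y := fun h => h.individualizedRel hE hX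
  have hnt : ∀ {a b}, (disparity G R).Adj a b → ∃ b', b' ≠ b ∧ P b b' := by
    intro a b hab
    obtain ⟨b', hb', -, hne⟩ := hR.exists_adj_iff_not hab
    exact ⟨b', fun h => by subst h; tauto, hP.1.symm (hRP hb')⟩
  have hF : ∀ {y}, (∃ y', y' ≠ y ∧ P y y') → (∀ x, P y x → x ∉ E → x ∈ F) →
      ∀ x, P y x → x ∈ F := by
    rintro y ⟨y', hne, hy'⟩ h x hx
    refine h x hx fun hxE => hne ?_
    rw [individualizedRel.eq_of_mem hxE hx,
      individualizedRel.eq_of_mem hxE (hP.1.trans (hP.1.symm hy') hx)]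
  have hstep : ∀ {a b}, (disparity G R).Adj a b → (∀ x, P a x → x ∈ W ∪ F) →
      ∀ x, P b x → x ∉ E → x ∈ F := by
    intro a b hab ha x hx hxE
    by_contra hxF
    obtain ⟨a', ha', hab', hne⟩ := hR.exists_adj_iff_not hab.symm
    have haa' := hP.1.symm (hRP ha')
    have hconst : ∀ {d e}, P a d → P a e → (G.Adj x d ↔ G.Adj x e) := fun hd he =>
      individualizedRel_of_numClasses_le (hstuck x hxE hxF) (ha _ hd) (ha _ he)
        (hP.1.trans (hP.1.symm hd) he)
    have hc := hP.card_congr (p := fun y => P a y) (fun _ _ h h' => hP.1.trans h' h) hx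
    have hex : ∃ y, P a y ∧ G.Adj b y := by
      by_cases h : G.Adj b a
      · exact ⟨a, hP.1.refl a, h⟩
      · exact ⟨a', haa', by tauto⟩
    obtain ⟨y, hay, hby⟩ := hex
    have hpos : 0 < (Finset.univ.filter fun y => G.Adj b y ∧ P a y).card :=
      Finset.card_pos.2 ⟨y, by simp [hay, hby]⟩
    rw [hc] at hpos
    obtain ⟨y1, hy1⟩ := Finset.card_pos.1 hpos
    simp only [Finset.mem_filter, Finset.mem_univ, true_and] at hy1
    have hall : ∀ y, P a y → G.Adj x y := fun y hy => (hconst hy1.2 hy).1 hy1.1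
    have hsub : (Finset.univ.filter fun y => G.Adj x y ∧ P a y) =
        Finset.univ.filter fun y => P a y := by
      ext y; simp only [Finset.mem_filter, Finset.mem_univ, true_and]
      exact ⟨fun h => h.2, fun h => ⟨hall y h, h⟩⟩
    have hall' : (Finset.univ.filter fun y => G.Adj b y ∧ P a y) =
        Finset.univ.filter fun y => P a y := by
      refine Finset.eq_of_subset_of_card_le (fun y hy => ?_) (by rw [hc, hsub])
      simp only [Finset.mem_filter, Finset.mem_univ, true_and] at hy ⊢
      exact hy.2
    have hb_all : ∀ y, P a y → G.Adj b y := fun y hy => by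
      have : y ∈ Finset.univ.filter fun y => P a y := by simp [hy]
      rw [← hall'] at this
      simpa using (Finset.mem_filter.1 this).2.1
    have h1 := hb_all a (hP.1.refl a)
    have h2 := hb_all a' haa'
    tauto
  have hbase : (∃ y', y' ≠ z ∧ P z y') ∧ ∀ x, P z x → x ∈ F := by
    have hzW : ∀ x, P z x → x ∈ W := fun x hx =>
      hW x hx.color_eq.1.symm (hx.color_eq.2.1 hz)
    refine ⟨hnt hu.symm, hF (hnt hu.symm) fun x hx hxE => ?_⟩
    by_contra hxF
    obtain ⟨y', hne, hy'⟩ := hnt hu.symm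
    have hr' := individualizedRel_isStableRel (G := G) (c := c) (X := X) (insert x E)
    obtain ⟨w, hw, hwx⟩ : ∃ w, P z w ∧ w ≠ x := by
      by_cases h : z = x
      · exact ⟨y', hy', h ▸ hne⟩
      · exact ⟨z, hP.1.refl z, h⟩
    have hlt := numClasses_lt hr'.1 hP.1
      (fun _ _ => individualizedRel.mono (Finset.subset_insert x E))
      (Finset.mem_union_left F (hzW w hw)) (Finset.mem_union_left F (hzW x hx))
      (hP.1.trans (hP.1.symm hw) hx)
      fun h => hwx (h.eq_of_mem (Finset.mem_insert_self x E))
    exact absurd (hstuck x hxE hxF) (not_le.2 hlt)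
  refine fun y hy => compSet_subset (S := {y | (∃ y', y' ≠ y ∧ P y y') ∧ ∀ x, P y x → x ∈ F})
    hbase (fun a ha b hab => ⟨hnt hab, hF (hnt hab) (hstep hab fun x hx => ?_)⟩) hy
  exact Finset.mem_union_right W (ha.2 x hx)

/-- In the situation of `class_subset_of_numClasses_le`, a large disparity component forces many
more unindividualised than individualised vertices. -/
theorem two_mul_card_add_card_compSet_le {f : V → Bool} {E F W : Finset V} {z : V}
    (hE : ∀ v ∈ E, f v = true) (hX : ∀ x ∈ X, ∀ y, crStable G (refineColor c f) x y → y ∈ X)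
    (hz : z ∈ X) (hW : ∀ x, c x = c z → x ∈ X → x ∈ W)
    (hstuck : ∀ x, x ∉ E → x ∉ F →
      numClasses (individualizedRel G c X (insert x E)) (W ∪ F) ≤
        numClasses (individualizedRel G c X E) (W ∪ F))
    (hEn : E.card ≤ numClasses (individualizedRel G c X E) (W ∪ F))
    (hlarge : 1 < Nat.card (compSet (disparity G (crStable G (refineColor c f))) z)) :
    2 * E.card + Nat.card (compSet (disparity G (crStable G (refineColor c f))) z) ≤
      2 * W.card + 2 * F.card := by
  set R := crStable G (refineColor c f) with hRdef
  set P := individualizedRel G c X E with hPdef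
  have hP : IsStableRel G P := individualizedRel_isStableRel _
  obtain ⟨u, hu⟩ : ∃ u, (disparity G R).Adj z u := by
    by_contra! hcon
    have hsub : compSet (disparity G R) z ⊆ {z} :=
      compSet_subset rfl fun a ha b hab => absurd (Set.mem_singleton_iff.1 ha ▸ hab) (hcon b)
    have := Nat.card_mono (Set.toFinite _) hsub
    rw [Nat.card_coe_set_eq {z}, Set.ncard_singleton] at this
    omega
  have hcl := class_subset_of_numClasses_le hE hX hz hW hstuck hu
  let K := F.filter fun x => ∃ y ∈ compSet (disparity G R) z, P y x
  have hKF : K ⊆ F := Finset.filter_subset _ _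
  have hZK : Nat.card (compSet (disparity G R) z) ≤ K.card := by
    rw [Nat.card_eq_fintype_card, ← Set.toFinset_card]
    refine Finset.card_le_card fun y hy => ?_
    have hy' := Set.mem_toFinset.1 hy
    exact Finset.mem_filter.2 ⟨(hcl y hy').2 y (hP.1.refl y), y, hy', hP.1.refl y⟩
  have hK2 : 2 * numClasses P K ≤ K.card := by
    refine Finset.mul_card_image_le_card K 2 fun C hC => ?_
    obtain ⟨x, hx, rfl⟩ := Finset.mem_image.1 hC
    obtain ⟨hxF, y, hy, hyx⟩ := Finset.mem_filter.1 hx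
    obtain ⟨⟨y', hne, hyy'⟩, hF⟩ := hcl y hy
    have hmem : ∀ w, P y w → w ∈ K.filter fun a =>
        Finset.univ.filter (P a) = Finset.univ.filter (P x) := fun w hw =>
      Finset.mem_filter.2 ⟨Finset.mem_filter.2 ⟨hF w hw, y, hy, hw⟩,
        (filter_class_eq_iff hP.1).2 (hP.1.trans (hP.1.symm hw) hyx)⟩
    exact Finset.one_lt_card.2 ⟨y', hmem y' hyy', y, hmem y (hP.1.refl y), hne⟩
  have hN : numClasses P (W ∪ F) ≤ W.card + (F \ K).card + numClasses P K := by
    have : W ∪ F = (W ∪ F \ K) ∪ K := by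
      rw [Finset.union_assoc, Finset.sdiff_union_of_subset hKF]
    rw [this]
    unfold numClasses
    rw [Finset.image_union]
    refine (Finset.card_union_le _ _).trans (Nat.add_le_add_right ?_ _)
    exact Finset.card_image_le.trans (Finset.card_union_le _ _)
  rw [Finset.card_sdiff_of_subset hKF] at hN
  have := Finset.card_le_card hKF
  omega

end Disparity

section BernoulliProduct

open Classical

variable {ι : Type*} [Fintype ι] {q : ι → ℝ}

/-- The probability, as a real number, of a set under a product of Bernoulli distributions. -/
noncomputable def bernoulliProb (q : ι → ℝ) (A : Set (ι → Bool)) : ℝ :=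
  ∑ f : ι → Bool with f ∈ A, ∏ i, if f i then q i else 1 - q i

/-- The event that all coordinates in `E` are `true` and all coordinates in `F` are `false`. -/
def boolCylinder (E F : Finset ι) : Set (ι → Bool) :=
  {f | (∀ i ∈ E, f i = true) ∧ ∀ i ∈ F, f i = false}

theorem bernoulliProduct_apply [DecidableEq ι] (h0 : ∀ i, 0 ≤ q i) (h1 : ∀ i, q i ≤ 1)
    (A : Set (ι → Bool)) :
    bernoulliProduct ι q A = ENNReal.ofReal (bernoulliProb q A) := by
  obtain rfl : ‹DecidableEq ι› = fun a b => Classical.propDecidable (a = b) := Subsingleton.elim _ _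
  have hw : ∀ (f : ι → Bool) i, 0 ≤ if f i then q i else 1 - q i := fun f i => by
    split_ifs
    · exact h0 i
    · linarith [h1 i]
  have hA : MeasurableSet A := A.toFinite.measurableSet
  rw [bernoulliProduct, Measure.finsetSum_apply, bernoulliProb, ENNReal.ofReal_sum_of_nonneg
    fun f _ => Finset.prod_nonneg fun i _ => hw f i, Finset.sum_filter]
  refine Finset.sum_congr rfl fun f _ => ?_
  rw [Measure.smul_apply, Measure.dirac_apply' _ hA, smul_eq_mul, Set.indicator_apply]
  split_ifs
  · rw [Pi.one_apply, mul_one, ENNReal.ofReal_prod_of_nonneg fun i _ => hw f i]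
    refine Finset.prod_congr rfl fun i _ => ?_
    split_ifs <;> rfl
  · rw [mul_zero]

theorem bernoulliProb_boolCylinder {E F : Finset ι} (h : Disjoint E F) :
    bernoulliProb q (boolCylinder E F) = (∏ i ∈ E, q i) * ∏ i ∈ F, (1 - q i) := by
  let t : ι → Finset Bool := fun i => if i ∈ E then {true} else if i ∈ F then {false} else .univ
  have ht : (Finset.univ.filter fun f : ι → Bool => f ∈ boolCylinder E F) = Fintype.piFinset t := by
    ext f
    rw [Fintype.mem_piFinset]
    refine Iff.trans (b := (∀ i ∈ E, f i = true) ∧ ∀ i ∈ F, f i = false)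
      (by rw [Finset.mem_filter]; exact and_iff_right (Finset.mem_univ _)) ?_
    simp only [t]
    constructor
    · rintro ⟨hE, hF⟩ i
      split_ifs with h1 h2
      · simp [hE i h1]
      · simp [hF i h2]
      · simp
    · intro hf
      refine ⟨fun i hi => by simpa [hi] using hf i, fun i hi => ?_⟩
      have : i ∉ E := Finset.disjoint_right.1 h hi
      simpa [hi, this] using hf i
  have hi : ∀ i, (∑ b ∈ t i, if b then q i else 1 - q i) =
      (if i ∈ E then q i else 1) * if i ∈ F then 1 - q i else 1 := by
    intro i
    by_cases h1 : i ∈ E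
    · simp [t, h1, Finset.disjoint_left.1 h h1]
    · by_cases h2 : i ∈ F <;> simp [t, h1, h2]
  rw [bernoulliProb, ht, ← Finset.prod_univ_sum t fun i b => if b then q i else 1 - q i,
    Finset.prod_congr rfl fun i _ => hi i, Finset.prod_mul_distrib, Finset.prod_ite_mem,
    Finset.prod_ite_mem, Finset.univ_inter, Finset.univ_inter]

theorem bernoulliProb_nonneg (h0 : ∀ i, 0 ≤ q i) (h1 : ∀ i, q i ≤ 1) (A : Set (ι → Bool)) :
    0 ≤ bernoulliProb q A :=
  Finset.sum_nonneg fun f _ => Finset.prod_nonneg fun i _ => by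
    split_ifs
    · exact h0 i
    · linarith [h1 i]

theorem bernoulliProb_mono (h0 : ∀ i, 0 ≤ q i) (h1 : ∀ i, q i ≤ 1) {A B : Set (ι → Bool)}
    (h : A ⊆ B) : bernoulliProb q A ≤ bernoulliProb q B := by
  refine Finset.sum_le_sum_of_subset_of_nonneg
    (Finset.monotone_filter_right _ fun f _ hf => h hf) fun f _ _ =>
      Finset.prod_nonneg fun i _ => ?_
  split_ifs
  · exact h0 i
  · linarith [h1 i]

theorem bernoulliProb_union_le (h0 : ∀ i, 0 ≤ q i) (h1 : ∀ i, q i ≤ 1) (A B : Set (ι → Bool)) :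
    bernoulliProb q (A ∪ B) ≤ bernoulliProb q A + bernoulliProb q B := by
  have e : bernoulliProb q (A ∪ B) =
      ∑ f ∈ (Finset.univ.filter fun f => f ∈ A) ∪ Finset.univ.filter fun f => f ∈ B,
        ∏ i, if f i then q i else 1 - q i :=
    Finset.sum_congr (by ext f; simp) fun _ _ => rfl
  rw [e, bernoulliProb, bernoulliProb, ← Finset.sum_union_inter]
  refine le_add_of_nonneg_right (Finset.sum_nonneg fun f _ => Finset.prod_nonneg fun i _ => ?_)
  split_ifs
  · exact h0 i
  · linarith [h1 i]

theorem bernoulliProb_iUnion_le {κ : Type*} [Fintype κ] (h0 : ∀ i, 0 ≤ q i) (h1 : ∀ i, q i ≤ 1)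
    (A : κ → Set (ι → Bool)) {ε : ℝ} (h : ∀ k, bernoulliProb q (A k) ≤ ε) :
    bernoulliProb q (⋃ k, A k) ≤ Fintype.card κ * ε := by
  have key : ∀ S : Finset κ, bernoulliProb q (⋃ k ∈ S, A k) ≤ S.card * ε := by
    intro S
    induction S using Finset.induction_on with
    | empty => simp [bernoulliProb]
    | insert a S ha ih =>
      rw [Finset.set_biUnion_insert, Finset.card_insert_of_notMem ha]
      refine (bernoulliProb_union_le h0 h1 _ _).trans ?_
      push_cast
      linarith [h a]
  simpa using key Finset.univ

theorem bernoulliProb_univ : bernoulliProb q Set.univ = 1 := by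
  have h := bernoulliProb_boolCylinder (q := q) (Finset.disjoint_empty_left (∅ : Finset ι))
  simpa [boolCylinder] using h

theorem bernoulliProb_add_compl (A : Set (ι → Bool)) :
    bernoulliProb q A + bernoulliProb q Aᶜ = 1 := by
  rw [← bernoulliProb_univ (q := q)]
  simp only [bernoulliProb, Set.mem_compl_iff, Set.mem_univ, Finset.filter_true]
  exact Finset.sum_filter_add_sum_filter_not _ _ _

/-- A bound for events that force a surplus of failures along an adaptive exposure of the
coordinates: `I E F` means that the state with successes `E` and failures `F` is reached, and at
every such state either a further coordinate can be exposed, or the event forces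
`M * 2 ^ #E ≤ 2 ^ #F`. -/
theorem bernoulliProb_mul_le_one_of_exposure (hq : ∀ i, 0.7 ≤ q i ∧ q i ≤ 1)
    (B : Set (ι → Bool)) {M : ℝ} (hM : 0 < M) (I : Finset ι → Finset ι → Prop) (hI : I ∅ ∅)
    (hstep : ∀ E F, Disjoint E F → I E F →
      (∃ v, v ∉ E ∧ v ∉ F ∧ I (insert v E) F ∧ I E (insert v F)) ∨
        ∀ f ∈ B ∩ boolCylinder E F, M * 2 ^ E.card ≤ 2 ^ F.card) :
    bernoulliProb q B * M ≤ 1 := by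
  have h0 : ∀ i, 0 ≤ q i := fun i => by linarith [(hq i).1]
  have h1 : ∀ i, q i ≤ 1 := fun i => (hq i).2
  have key : ∀ k E F, (Finset.univ \ (E ∪ F)).card = k → Disjoint E F → I E F →
      bernoulliProb q (B ∩ boolCylinder E F) * (M * 2 ^ E.card) ≤
        2 ^ F.card * ((∏ i ∈ E, q i) * ∏ i ∈ F, (1 - q i)) := by
    intro k
    induction k using Nat.strong_induction_on with
    | _ k ih =>
      intro E F hk hEF hIEF
      have hprod : 0 ≤ (∏ i ∈ E, q i) * ∏ i ∈ F, (1 - q i) :=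
        mul_nonneg (Finset.prod_nonneg fun i _ => h0 i)
          (Finset.prod_nonneg fun i _ => by linarith [h1 i])
      rcases hstep E F hEF hIEF with ⟨v, hvE, hvF, hI1, hI2⟩ | hB
      · have hlt : ∀ E' F' : Finset ι, E' ∪ F' = insert v (E ∪ F) →
            (Finset.univ \ (E' ∪ F')).card < k := by
          intro E' F' h
          rw [h, ← hk]
          refine Finset.card_lt_card ⟨Finset.sdiff_subset_sdiff le_rfl (Finset.subset_insert _ _),
            fun hs => ?_⟩
          have := hs (show v ∈ _ by simp [hvE, hvF])
          simp at this
        have a1 := ih _ (hlt (insert v E) F (Finset.insert_union _ _ _)) _ _ rfl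
          (Finset.disjoint_insert_left.2 ⟨hvF, hEF⟩) hI1
        have a2 := ih _ (hlt E (insert v F) (Finset.union_insert _ _ _)) _ _ rfl
          (Finset.disjoint_insert_right.2 ⟨hvE, hEF⟩) hI2
        have hsplit : B ∩ boolCylinder E F ⊆
            (B ∩ boolCylinder (insert v E) F) ∪ (B ∩ boolCylinder E (insert v F)) := by
          rintro f ⟨hfB, hfE, hfF⟩
          cases hfv : f v
          · refine Or.inr ⟨hfB, hfE, fun i hi => ?_⟩
            rcases Finset.mem_insert.1 hi with rfl | hi
            · exact hfv
            · exact hfF i hi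
          · refine Or.inl ⟨hfB, fun i hi => ?_, hfF⟩
            rcases Finset.mem_insert.1 hi with rfl | hi
            · exact hfv
            · exact hfE i hi
        have hle := (bernoulliProb_mono h0 h1 hsplit).trans (bernoulliProb_union_le h0 h1 _ _)
        rw [Finset.card_insert_of_notMem hvE, Finset.prod_insert hvE, pow_succ] at a1
        rw [Finset.card_insert_of_notMem hvF, Finset.prod_insert hvF, pow_succ] at a2
        have hpos : 0 < M * 2 ^ E.card := by positivity
        have hmul := mul_le_mul_of_nonneg_right hle hpos.le
        have hG : 0 ≤ 2 ^ F.card * ((∏ i ∈ E, q i) * ∏ i ∈ F, (1 - q i)) :=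
          mul_nonneg (by positivity) hprod
        nlinarith [mul_nonneg hG (sub_nonneg.2 (hq v).1)]
      · rcases (B ∩ boolCylinder E F).eq_empty_or_nonempty with he | ⟨f, hf⟩
        · rw [he]
          simpa [bernoulliProb] using hprod
        · rw [mul_comm (2 ^ F.card), ← bernoulliProb_boolCylinder hEF]
          exact mul_le_mul (bernoulliProb_mono h0 h1 Set.inter_subset_right) (hB f hf)
            (by positivity) (bernoulliProb_nonneg h0 h1 _)
  have := key _ ∅ ∅ rfl (Finset.disjoint_empty_left _) hI
  simpa [boolCylinder] using this

end BernoulliProduct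

section WithHighProbability

open Classical

variable {V Ω : Type*} (G : SimpleGraph V) (c : V → Ω) (L : ℝ)

/-- Every component of the disparity graph with at least `L` vertices is a union of classes of the
stable colouring of the refinement of `c` by `f`. -/
def largeComponentsClosed (f : V → Bool) : Prop :=
  ∀ v, L ≤ (Nat.card (compSet (disparity G fun x y => c x = c y) v) : ℝ) →
    ∀ x ∈ compSet (disparity G fun x y => c x = c y) v,
    ∀ y, crStable G (refineColor c f) x y →
      y ∈ compSet (disparity G fun x y => c x = c y) v

/-- Every component of the refined disparity graph is small compared to the intersections of
colour classes and components of the original disparity graph that it meets. -/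
def refinedComponentsSmall (f : V → Bool) : Prop :=
  ∀ z, (Nat.card (compSet (disparity G (crStable G (refineColor c f))) z) : ℝ) ≤
    5 * (Nat.card {x // c x = c z ∧ x ∈ compSet (disparity G fun x y => c x = c y) z} : ℝ) + 5 * L

variable {G c L}

theorem compSet_eq_of_mem {u v : V} (h : u ∈ compSet G v) :
    compSet G u = compSet G v :=
  Set.ext fun _ => ⟨SimpleGraph.Reachable.trans h, (SimpleGraph.Reachable.symm h).trans⟩

theorem refinedComponentsSmall.forall {f : V → Bool} (h : refinedComponentsSmall G c L f)
    (u v w : V)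
    (hz : ∃ z, z ∈ compSet (disparity G (crStable G (refineColor c f))) w ∧ c z = c u ∧
      z ∈ compSet (disparity G fun x y => c x = c y) v) :
    (Nat.card (compSet (disparity G (crStable G (refineColor c f))) w) : ℝ) ≤
      5 * (Nat.card {z // c z = c u ∧ z ∈ compSet (disparity G fun x y => c x = c y) v} : ℝ) +
        5 * L := by
  obtain ⟨z, hzw, hzu, hzv⟩ := hz
  have := h z
  rwa [compSet_eq_of_mem hzw, compSet_eq_of_mem hzv, hzu] at this

variable [Fintype V] {q : V → ℝ}

theorem bernoulliProb_not_largeComponentsClosed_le (hq : ∀ i, 0.7 ≤ q i ∧ q i ≤ 1) :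
    bernoulliProb q {f | ¬ largeComponentsClosed G c L f} ≤ Fintype.card V * (0.3 : ℝ) ^ L := by
  have h0 : ∀ i, 0 ≤ q i := fun i => by linarith [(hq i).1]
  have h1 : ∀ i, q i ≤ 1 := fun i => (hq i).2
  set D := disparity G fun x y => c x = c y with hD
  have hs : Equivalence fun x y => c x = c y := ⟨fun _ => rfl, Eq.symm, Eq.trans⟩
  let A : V → Set (V → Bool) := fun v =>
    {f | L ≤ (Nat.card (compSet D v) : ℝ) ∧ f ∈ boolCylinder ∅ (compSet D v).toFinset}
  have hsub : {f | ¬ largeComponentsClosed G c L f} ⊆ ⋃ v, A v := by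
    intro f hf
    simp only [largeComponentsClosed, Set.mem_ofPred_eq] at hf
    push Not at hf
    obtain ⟨v, hv, x, hx, y, hxy, hy⟩ := hf
    refine Set.mem_iUnion.2 ⟨v, hv, by simp, fun x' hx' => ?_⟩
    have hr := crStable_isStableRel G (refineColor c f)
    have hx'v : x' ∈ compSet D v := Set.mem_toFinset.1 hx'
    obtain ⟨y', hyy', hxy'⟩ := hr.exists_reachable hs
      (fun _ _ => crStable_refineColor_color_eq) hxy
      ((show D.Reachable v x from hx).symm.trans
        (show D.Reachable v x' from hx'v))
    by_contra hcon
    have : y' = x' := crStable_refineColor_eq (by simpa using hcon) (hr.1.symm hxy')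
    subst this
    exact hy ((show D.Reachable v y' from hx'v).trans hyy'.symm)
  refine (bernoulliProb_mono h0 h1 hsub).trans (bernoulliProb_iUnion_le h0 h1 A fun v => ?_)
  by_cases hv : L ≤ (Nat.card (compSet D v) : ℝ)
  · have hA : A v = boolCylinder ∅ (compSet D v).toFinset :=
      Set.ext fun f => ⟨fun h => h.2, fun h => ⟨hv, h⟩⟩
    rw [hA, bernoulliProb_boolCylinder (Finset.disjoint_empty_left _), Finset.prod_empty, one_mul]
    calc ∏ i ∈ (compSet D v).toFinset, (1 - q i) ≤ ∏ i ∈ (compSet D v).toFinset, (0.3 : ℝ) :=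
          Finset.prod_le_prod (fun i _ => by linarith [h1 i]) fun i _ => by linarith [(hq i).1]
      _ = (0.3 : ℝ) ^ (Nat.card (compSet D v) : ℝ) := by
          rw [Finset.prod_const, Set.toFinset_card, Real.rpow_natCast, Nat.card_eq_fintype_card]
      _ ≤ (0.3 : ℝ) ^ L := Real.rpow_le_rpow_of_exponent_ge (by norm_num) (by norm_num) hv
  · have hA : A v = ∅ := Set.eq_empty_of_forall_notMem fun f h => hv h.1
    rw [hA]
    simpa [bernoulliProb] using Real.rpow_nonneg (by norm_num) L

/-- The exposure argument: for fixed `z`, a large refined component of `z` is unlikely. -/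
theorem bernoulliProb_large_compSet_mul_le (hq : ∀ i, 0.7 ≤ q i ∧ q i ≤ 1) (hL : 0 ≤ L) {z : V}
    {X : Set V} (hz : z ∈ X) :
    bernoulliProb q {f | (∀ x ∈ X, ∀ y, crStable G (refineColor c f) x y → y ∈ X) ∧
        5 * (Nat.card {x // c x = c z ∧ x ∈ X} : ℝ) + 5 * L <
          Nat.card (compSet (disparity G (crStable G (refineColor c f))) z)} *
      (2 : ℝ) ^ (5 / 2 * L) ≤ 1 := by
  set W : Finset V := Finset.univ.filter fun x => c x = c z ∧ x ∈ X with hWdef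
  have hWcard : Nat.card {x // c x = c z ∧ x ∈ X} = W.card := by
    rw [Nat.card_eq_fintype_card, Fintype.card_subtype]
  have hWpos : 1 ≤ W.card := Finset.card_pos.2 ⟨z, by simp [hWdef, hz]⟩
  refine bernoulliProb_mul_le_one_of_exposure hq _ (by positivity)
    (fun E F => E.card ≤ numClasses (individualizedRel G c X E) (W ∪ F)) (by simp)
    fun E F _ hI => ?_
  by_cases hv : ∃ v, v ∉ E ∧ v ∉ F ∧ numClasses (individualizedRel G c X E) (W ∪ F) <
      numClasses (individualizedRel G c X (insert v E)) (W ∪ F)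
  · obtain ⟨v, hvE, hvF, hlt⟩ := hv
    refine Or.inl ⟨v, hvE, hvF, ?_, hI.trans (numClasses_mono_right
      (Finset.union_subset_union_right (Finset.subset_insert v F)))⟩
    rw [Finset.card_insert_of_notMem hvE]
    omega
  · push Not at hv
    right
    rintro f ⟨⟨hX, hbig⟩, hE, hF⟩
    rw [hWcard] at hbig
    have hWpos' : (1 : ℝ) ≤ W.card := by exact_mod_cast hWpos
    have hcard := two_mul_card_add_card_compSet_le hE hX hz
      (W := W) (F := F) (fun x h1 h2 => by simp [hWdef, h1, h2]) hv hI
      (by have : (1 : ℝ) < Nat.card (compSet (disparity G (crStable G (refineColor c f))) z) := by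
            linarith
          exact_mod_cast this)
    have hcard' : (2 * E.card + Nat.card (compSet (disparity G (crStable G (refineColor c f))) z) :
        ℝ) ≤ 2 * W.card + 2 * F.card := by exact_mod_cast hcard
    rw [← Real.rpow_natCast, ← Real.rpow_natCast, ← Real.rpow_add two_pos]
    exact Real.rpow_le_rpow_of_exponent_le one_le_two (by linarith)

theorem bernoulliProb_not_good_le (hq : ∀ i, 0.7 ≤ q i ∧ q i ≤ 1) (hL : 0 ≤ L) :
    bernoulliProb q {f | ¬ (largeComponentsClosed G c L f ∧ refinedComponentsSmall G c L f)} ≤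
      Fintype.card V * (0.3 : ℝ) ^ L + Fintype.card V * (2 : ℝ) ^ (-(5 / 2 * L)) := by
  have h0 : ∀ i, 0 ≤ q i := fun i => by linarith [(hq i).1]
  have h1 : ∀ i, q i ≤ 1 := fun i => (hq i).2
  have hs : Equivalence fun x y => c x = c y := ⟨fun _ => rfl, Eq.symm, Eq.trans⟩
  let A : V → Set (V → Bool) := fun z =>
    {f | (∀ x ∈ compSet (disparity G fun x y => c x = c y) z, ∀ y,
        crStable G (refineColor c f) x y → y ∈ compSet (disparity G fun x y => c x = c y) z) ∧
      5 * (Nat.card {x // c x = c z ∧ x ∈ compSet (disparity G fun x y => c x = c y) z} : ℝ) +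
        5 * L < Nat.card (compSet (disparity G (crStable G (refineColor c f))) z)}
  have hsub : {f | ¬ (largeComponentsClosed G c L f ∧ refinedComponentsSmall G c L f)} ⊆
      {f | ¬ largeComponentsClosed G c L f} ∪ ⋃ z, A z := by
    intro f hf
    by_cases hc : largeComponentsClosed G c L f
    · right
      have hf' : ¬ refinedComponentsSmall G c L f := fun h => hf ⟨hc, h⟩
      simp only [refinedComponentsSmall] at hf'
      push Not at hf'
      obtain ⟨z, hz⟩ := hf'
      refine Set.mem_iUnion.2 ⟨z, ?_, hz⟩
      by_cases hX : L ≤ (Nat.card (compSet (disparity G fun x y => c x = c y) z) : ℝ)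
      · exact hc z hX
      · have := (crStable_isStableRel G (refineColor c f)).card_compSet_le hs
          (fun _ _ => crStable_refineColor_color_eq) hc (not_le.1 hX)
        have hnn : (0 : ℝ) ≤ Nat.card
          {x // c x = c z ∧ x ∈ compSet (disparity G fun x y => c x = c y) z} := Nat.cast_nonneg _
        linarith
    · exact Or.inl hc
  refine (bernoulliProb_mono h0 h1 hsub).trans ((bernoulliProb_union_le h0 h1 _ _).trans
    (add_le_add (bernoulliProb_not_largeComponentsClosed_le hq)
      (bernoulliProb_iUnion_le h0 h1 A fun z => ?_)))
  rw [Real.rpow_neg two_pos.le, ← one_div, le_div_iff₀ (by positivity)]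
  exact bernoulliProb_large_compSet_mul_le hq hL (.refl z)

theorem tendsto_card_mul_rpow_log {b : ℝ} (hb : 0 < b) (hb' : Real.log b < -1) :
    Tendsto (fun n : ℕ => (n : ℝ) * b ^ Real.log n) atTop (nhds 0) := by
  have h : Tendsto (fun n : ℕ => (n : ℝ) ^ (-(-1 - Real.log b))) atTop (nhds 0) :=
    (tendsto_rpow_neg_atTop (by linarith)).comp tendsto_natCast_atTop_atTop
  refine h.congr' ?_
  filter_upwards [eventually_gt_atTop 0] with n hn
  have hn' : (0 : ℝ) < n := by exact_mod_cast hn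
  rw [Real.rpow_def_of_pos hb, Real.rpow_def_of_pos hn']
  nth_rewrite 2 [← Real.exp_log hn']
  rw [← Real.exp_add]
  ring_nf

end WithHighProbability


/-- Lemma 5.7.
For an `n`-vertex graph `H` with equitable colouring `c`, if each vertex is independently
given a brand-new unique colour with probability at least `0.7`, then whp: (1) every component
of `D(H,c)` with at least `log n` vertices is a union of colour classes of `R*c'`; and
(2) for every colour class `C` of `c` and component `X` of `D(H,c)`, every component of
`D(H, R*c')` meeting `C ∩ X` has at most `5|C ∩ X| + 5 log n` vertices. -/
theorem stmt15 (Ω : ℕ → Type) (H : ∀ n : ℕ, SimpleGraph (Fin n))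
    (c : ∀ n : ℕ, Fin n → Ω n) (heq : ∀ n, IsEquitable (H n) (c n))
    (q : ∀ n : ℕ, Fin n → ℝ) (hq : ∀ n v, 0.7 ≤ q n v ∧ q n v ≤ 1) :
    Tendsto (fun n : ℕ =>
      bernoulliProduct (Fin n) (q n)
        {f |
          (∀ v : Fin n,
            Real.log n ≤
              (Nat.card ↥(compSet (disparity (H n) fun x y => c n x = c n y) v) : ℝ) →
            ∀ x ∈ compSet (disparity (H n) fun x y => c n x = c n y) v,
            ∀ y : Fin n, crStable (H n) (refineColor (c n) f) x y →
              y ∈ compSet (disparity (H n) fun x y => c n x = c n y) v) ∧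
          (∀ u v w : Fin n,
            (∃ z : Fin n,
              z ∈ compSet (disparity (H n) (crStable (H n) (refineColor (c n) f))) w ∧
              c n z = c n u ∧ z ∈ compSet (disparity (H n) fun x y => c n x = c n y) v) →
            (Nat.card ↥(compSet
                (disparity (H n) (crStable (H n) (refineColor (c n) f))) w) : ℝ) ≤
              5 * (Nat.card {z : Fin n // c n z = c n u ∧
                  z ∈ compSet (disparity (H n) fun x y => c n x = c n y) v} : ℝ) +
                5 * Real.log n)})
      atTop (nhds 1) := by
  have hlog3 : Real.log 0.3 < -1 := by
    rw [Real.log_lt_iff_lt_exp (by norm_num), Real.exp_neg, lt_inv_comm₀ (by norm_num)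
      (Real.exp_pos 1)]
    have := Real.exp_one_lt_d9
    norm_num
    linarith
  have hlog2 : Real.log ((2 : ℝ) ^ (-(5 / 2) : ℝ)) < -1 := by
    rw [Real.log_rpow two_pos]
    linarith [Real.log_two_gt_d9]
  have hlim : Tendsto (fun n : ℕ => 1 - ((n : ℝ) * (0.3 : ℝ) ^ Real.log n +
      (n : ℝ) * ((2 : ℝ) ^ (-(5 / 2) : ℝ)) ^ Real.log n)) atTop (nhds 1) := by
    simpa using ((tendsto_card_mul_rpow_log (by norm_num) hlog3).add
      (tendsto_card_mul_rpow_log (by positivity) hlog2)).const_sub 1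
  have h0 : ∀ n v, 0 ≤ q n v := fun n v => by linarith [(hq n v).1]
  have h1 : ∀ n v, q n v ≤ 1 := fun n v => (hq n v).2
  have hprob : Tendsto (fun n : ℕ => bernoulliProb (q n) {f |
      largeComponentsClosed (H n) (c n) (Real.log n) f ∧
        refinedComponentsSmall (H n) (c n) (Real.log n) f}) atTop (nhds 1) := by
    refine tendsto_of_tendsto_of_tendsto_of_le_of_le hlim tendsto_const_nhds (fun n => ?_)
      fun n => ?_
    · have hle := bernoulliProb_not_good_le (G := H n) (c := c n) (hq n) (Real.log_natCast_nonneg n)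
      have hadd := bernoulliProb_add_compl (q := q n) {f |
        largeComponentsClosed (H n) (c n) (Real.log n) f ∧
          refinedComponentsSmall (H n) (c n) (Real.log n) f}
      rw [Fintype.card_fin, ← neg_mul, Real.rpow_mul two_pos.le] at hle
      simp only [Set.compl_ofPred] at hadd
      linarith
    · rw [← bernoulliProb_univ (q := q n)]
      exact bernoulliProb_mono (h0 n) (h1 n) (Set.subset_univ _)
  have hE := ENNReal.tendsto_ofReal hprob
  rw [ENNReal.ofReal_one] at hE
  refine tendsto_of_tendsto_of_tendsto_of_le_of_le hE tendsto_const_nhds (fun n => ?_) fun n => ?_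
  · simp only [bernoulliProduct_apply (h0 n) (h1 n)]
    exact ENNReal.ofReal_le_ofReal (bernoulliProb_mono (h0 n) (h1 n)
      fun f hf => ⟨hf.1, fun u v w hz => hf.2.forall u v w hz⟩)
  · simp only [bernoulliProduct_apply (h0 n) (h1 n)]
    rw [← ENNReal.ofReal_one, ← bernoulliProb_univ (q := q n)]
    exact ENNReal.ofReal_le_ofReal (bernoulliProb_mono (h0 n) (h1 n) (Set.subset_univ _))
end
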